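/- arXiv:2401.00485 — 3 statements merged into one kernel-verified Lean document; each statement's English description precedes it below -/
import Mathlib

section
/- Let A be a unital C*-algebra of real rank zero, let B be a complex unital Banach algebra, let T : A → B be a surjective additive map with σ(Tx) = σ(x) for all x ∈ A (so T is bijective), and let S : A → B be a unital Jordan homomorphism with Sa = Ta for every self-adjoint a ∈ A. Put R = T⁻¹ ∘ S : A → A. Then for every λ ∈ ℂ and every idempotent p ∈ A, the element λ·Rp + (1 − λ)·(−i·R(ip)) is an idempotent in A. -/
theorem tendsto_pow_zero_of_spectrum_norm_lt_one {A : Type*} [NormedRing A]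
    [NormedAlgebra ℂ A] [CompleteSpace A] {w : A} (h : ∀ z ∈ spectrum ℂ w, ‖z‖ < 1) :
    Filter.Tendsto (fun n : ℕ => w ^ n) Filter.atTop (nhds 0) := by
  nontriviality A
  have h1 : spectralRadius ℂ w < (1 : NNReal) :=
    spectrum.spectralRadius_lt_of_forall_lt _ fun z hz => h z hz
  obtain ⟨q, hq, hq1⟩ := ENNReal.lt_iff_exists_nnreal_btwn.1 h1
  have hq1' : q < 1 := by exact_mod_cast hq1
  have h2 := (spectrum.pow_nnnorm_pow_one_div_tendsto_nhds_spectralRadius w).eventually_lt_const hq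
  refine squeeze_zero_norm' ?_ (tendsto_pow_atTop_nhds_zero_of_lt_one q.2 (by exact_mod_cast hq1'))
  filter_upwards [h2, Filter.eventually_gt_atTop 0] with n hn hn0
  have hn0' : (n : ℝ) ≠ 0 := by positivity
  have := ENNReal.rpow_le_rpow hn.le (Nat.cast_nonneg (α := ℝ) n)
  rw [← ENNReal.rpow_mul, one_div_mul_cancel hn0', ENNReal.rpow_one, ENNReal.rpow_natCast] at this
  exact_mod_cast this

section CStar

variable {A : Type*} [CStarAlgebra A] [PartialOrder A] [StarOrderedRing A]

theorem isUnit_of_smul_one_le_add_star {y : A} {c : ℝ} (hc : 0 < c)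
    (h : c • (1 : A) ≤ y + star y) : IsUnit y := by
  set K : ℝ := ‖y‖ ^ 2
  have hK : 0 ≤ K := by positivity
  set t : ℝ := c / (K + 1)
  have ht : 0 < t := by positivity
  have htK : t * K < c := by
    have : t * (K + 1) = c := by simp only [t]; field_simp
    nlinarith
  set w : A := 1 - t • y with hw
  have hexp : star w * w = 1 - t • (y + star y) + (t * t) • (star y * y) := by
    simp only [hw, star_sub, star_one, star_smul, star_trivial, sub_mul, mul_sub, one_mul, mul_one,
      smul_mul_assoc, mul_smul_comm]
    module
  have h1 : star y * y ≤ K • (1 : A) := by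
    simpa [Algebra.algebraMap_eq_smul_one, K] using
      (CStarAlgebra.star_mul_le_algebraMap_norm_sq (a := y))
  set r : ℝ := max 0 (1 - t * c + t * t * K)
  have hr0 : 0 ≤ r := le_max_left _ _
  have hr1 : r < 1 := by
    refine max_lt one_pos ?_
    nlinarith [mul_lt_mul_of_pos_left htK ht]
  have h2 : star w * w ≤ algebraMap ℝ A r := by
    rw [hexp, Algebra.algebraMap_eq_smul_one]
    calc 1 - t • (y + star y) + (t * t) • (star y * y)
        ≤ 1 - t • (c • (1 : A)) + (t * t) • (K • (1 : A)) := by gcongr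
      _ = (1 - t * c + t * t * K) • (1 : A) := by module
      _ ≤ r • (1 : A) := by gcongr; exact le_max_right _ _
  have h3 : ‖star w * w‖ ≤ r :=
    (CStarAlgebra.norm_le_iff_le_algebraMap _ hr0 (star_mul_self_nonneg w)).2 h2
  rw [CStarRing.norm_star_mul_self] at h3
  have h4 : ‖w‖ < 1 := by nlinarith [norm_nonneg w]
  have h5 : IsUnit (t • y) := by simpa [hw] using isUnit_one_sub_of_norm_lt_one h4
  have h6 := h5.smul (Units.mk0 t ht.ne')⁻¹
  simpa [Units.smul_def, smul_smul, ht.ne'] using h6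

theorem re_neg_of_mem_spectrum {x : A} {c : ℝ} (hc : 0 < c)
    (h : x + star x ≤ -(c • (1 : A))) {z : ℂ} (hz : z ∈ spectrum ℂ x) : z.re < 0 := by
  by_contra! hre
  refine hz (isUnit_of_smul_one_le_add_star hc ?_)
  have h1 : algebraMap ℂ A z + star (algebraMap ℂ A z) = (2 * z.re) • (1 : A) := by
    rw [← algebraMap_star_comm, ← map_add, Complex.star_def, Complex.add_conj,
      Algebra.algebraMap_eq_smul_one]
    exact Complex.coe_smul _ _
  calc c • (1 : A) ≤ -(x + star x) := le_neg_of_le_neg h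
    _ ≤ (2 * z.re) • (1 : A) + -(x + star x) :=
      le_add_of_nonneg_left (smul_nonneg (by positivity) zero_le_one)
    _ = _ := by rw [← h1, star_sub]; abel

theorem nonneg_of_mul_add_star_mul_nonpos {y j : A} (hy : ∀ z ∈ spectrum ℂ y, z.re < 0)
    (hj : j * y + star y * j ≤ 0) : 0 ≤ j := by
  have h1 : IsUnit (1 - y) := by
    by_contra h
    have : (1 : ℂ) ∈ spectrum ℂ y := by rwa [spectrum.mem_iff, map_one]
    have := hy _ this
    norm_num at this
  obtain ⟨u, hu⟩ := h1
  set v : A := ↑u⁻¹ with hv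
  have huv : (1 - y) * v = 1 := by rw [← hu, hv, Units.mul_inv]
  set w : A := (1 + y) * v with hw
  have hspec : ∀ z ∈ spectrum ℂ w, ‖z‖ < 1 := by
    intro z hz
    by_contra! hz1
    refine hz ?_
    have hvu : IsUnit v := u⁻¹.isUnit
    have e : algebraMap ℂ A z - w = ((z - 1) • (1 : A) - (z + 1) • y) * v := by
      have e' : z • (1 : A) = (z • (1 - y)) * v := by rw [smul_mul_assoc, huv]
      rw [Algebra.algebraMap_eq_smul_one, e', hw, ← sub_mul]
      congr 1
      module
    rw [spectrum.mem_resolventSet_iff, e]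
    refine IsUnit.mul ?_ hvu
    by_cases hz0 : z + 1 = 0
    · have hz' : z - 1 ≠ 0 := by
        intro h
        have : (2 : ℂ) = 0 := by linear_combination hz0 - h
        norm_num at this
      simpa [hz0, Units.smul_def] using (isUnit_one (M := A)).smul (Units.mk0 _ hz')
    · have hmem : (z - 1) / (z + 1) ∉ spectrum ℂ y := by
        intro hm
        have hre := hy _ hm
        have hsq : 1 ≤ Complex.normSq z := by
          rw [Complex.normSq_eq_norm_sq]; nlinarith
        have : 0 < Complex.normSq (z + 1) := Complex.normSq_pos.2 hz0
        rw [Complex.div_re, ← add_div, div_lt_iff₀ this] at hre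
        simp [Complex.normSq_apply] at hre hsq
        nlinarith
      have := (spectrum.notMem_iff.1 hmem).smul (Units.mk0 _ hz0)
      simpa [Units.smul_def, smul_sub, Algebra.algebraMap_eq_smul_one, smul_smul,
        mul_div_cancel₀ _ hz0] using this
  have hstep : star w * j * w ≤ j := by
    have e : j - star w * j * w = star v * (-(2 • (j * y + star y * j))) * v := by
      have e1 : j = star ((1 - y) * v) * j * ((1 - y) * v) := by simp [huv]
      nth_rewrite 1 [e1]
      simp only [hw, star_mul, star_add, star_sub, star_one]
      noncomm_ring
    rw [← sub_nonneg, e]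
    refine star_left_conjugate_nonneg ?_ v
    exact neg_nonneg.2 (nsmul_nonpos hj 2)
  have hpow : ∀ n : ℕ, star (w ^ n) * j * w ^ n ≤ j := by
    intro n
    induction n with
    | zero => simp
    | succ n ih =>
      calc star (w ^ (n + 1)) * j * w ^ (n + 1)
          = star (w ^ n) * (star w * j * w) * w ^ n := by
            rw [pow_succ', star_mul]; noncomm_ring
        _ ≤ star (w ^ n) * j * w ^ n := star_left_conjugate_le_conjugate hstep _
        _ ≤ j := ih
  have ht := tendsto_pow_zero_of_spectrum_norm_lt_one hspec
  have ht2 : Filter.Tendsto (fun n : ℕ => star (w ^ n) * j * w ^ n) Filter.atTop (nhds 0) := by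
    simpa using ((ht.star.mul_const j).mul ht)
  exact le_of_tendsto' ht2 hpow

theorem exists_nonneg_add_smul_one_sub {f w : A} (hf : IsStarProjection f)
    (hw : IsSelfAdjoint w) {δ : ℝ} (hδ : 0 < δ) (h : δ • f ≤ f * w * f) :
    ∃ N : ℝ, ∀ n : ℝ, N ≤ n → 0 ≤ w + n • (1 - f) := by
  set g : A := 1 - f with hg
  have hff : f * f = f := hf.isIdempotentElem
  have hfs : star f = f := hf.isSelfAdjoint
  have hgs : star g = g := by simp [hg, hfs]
  have hgp : IsStarProjection g := hf.one_sub
  have hgg : g * g = g := hgp.isIdempotentElem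
  have hg0 : 0 ≤ g := hgp.nonneg
  set s : ℝ := Real.sqrt δ
  have hs : 0 < s := Real.sqrt_pos.2 hδ
  have hss : s * s = δ := Real.mul_self_sqrt hδ.le
  refine ⟨‖w‖ + δ⁻¹ * ‖w‖ ^ 2, fun n hn => ?_⟩
  set q : A := s • f + s⁻¹ • (f * w * g) with hq
  have e1 : star q * q = δ • f + f * w * g + g * w * f + δ⁻¹ • (g * (star (f * w) * (f * w)) * g) := by
    have e2 : star (f * w * g) = g * w * f := by
      simp only [star_mul, hgs, hfs, hw.star_eq, mul_assoc]
    have e3 : f * (f * w * g) = f * w * g := by simp only [← mul_assoc, hff]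
    have e4 : (g * w * f) * f = g * w * f := by rw [mul_assoc, hff]
    have e5 : g * (star (f * w) * (f * w)) * g = (g * w * f) * (f * w * g) := by
      rw [star_mul, hfs, hw.star_eq]; noncomm_ring
    rw [e5, hq, star_add, star_smul, star_smul, e2, hfs, star_trivial, star_trivial, add_mul,
      mul_add, mul_add, smul_mul_smul_comm, smul_mul_smul_comm, smul_mul_smul_comm,
      smul_mul_smul_comm, hff, e3, e4, inv_mul_cancel₀ hs.ne', mul_inv_cancel₀ hs.ne', one_smul,
      one_smul, ← mul_inv, hss]
    abel
  have h1 : -(‖w‖ • g) ≤ g * w * g := by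
    have := star_left_conjugate_le_conjugate hw.neg_algebraMap_norm_le_self g
    simpa [hgs, Algebra.algebraMap_eq_smul_one, hgg] using this
  have h2 : g * (star (f * w) * (f * w)) * g ≤ ‖w‖ ^ 2 • g := by
    have h3 : star (f * w) * (f * w) ≤ (‖w‖ ^ 2) • (1 : A) := by
      calc star (f * w) * (f * w) = star w * f * w := by
            rw [star_mul, hfs, mul_assoc, ← mul_assoc f, hff, mul_assoc]
        _ ≤ star w * 1 * w := star_left_conjugate_le_conjugate hf.le_one _
        _ ≤ _ := by
          simpa [Algebra.algebraMap_eq_smul_one] using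
            (CStarAlgebra.star_mul_le_algebraMap_norm_sq (a := w))
    have := star_left_conjugate_le_conjugate h3 g
    simpa [hgs, hgg] using this
  have e6 : w = f * w * f + f * w * g + g * w * f + g * w * g := by
    rw [hg]; noncomm_ring
  calc (0 : A) ≤ star q * q := star_mul_self_nonneg q
    _ = δ • f + f * w * g + g * w * f + δ⁻¹ • (g * (star (f * w) * (f * w)) * g) := e1
    _ ≤ f * w * f + f * w * g + g * w * f + δ⁻¹ • (‖w‖ ^ 2 • g) := by gcongr
    _ = f * w * f + f * w * g + g * w * f + -(‖w‖ • g) + (‖w‖ + δ⁻¹ * ‖w‖ ^ 2) • g := by module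
    _ ≤ f * w * f + f * w * g + g * w * f + g * w * g + n • g := by gcongr
    _ = w + n • g := by rw [← e6]

theorem exists_isStarProjection_of_not_nonpos
    (hrr0 : ∀ a : A, IsSelfAdjoint a → a ∈ closure {x : A | IsSelfAdjoint x ∧ IsUnit x})
    {d : A} (hd : IsSelfAdjoint d) (h : ¬ d ≤ 0) :
    ∃ f : A, IsStarProjection f ∧ f ≠ 0 ∧ ∃ δ : ℝ, 0 < δ ∧ δ • f ≤ f * d * f := by
  obtain ⟨ε, hε, hdε⟩ : ∃ ε : ℝ, 0 < ε ∧ ¬ d ≤ ε • (1 : A) := by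
    by_contra! hall
    refine h (ge_of_tendsto (x := nhdsWithin (0 : ℝ) (Set.Ioi 0)) (f := fun ε : ℝ => ε • (1 : A)) ?_
      (Filter.eventually_of_mem self_mem_nhdsWithin hall))
    have : Continuous fun ε : ℝ => ε • (1 : A) := by fun_prop
    simpa using (this.tendsto 0).mono_left nhdsWithin_le_nhds
  have hsa : IsSelfAdjoint (d - (ε / 2) • (1 : A)) :=
    hd.sub ((IsSelfAdjoint.all (ε / 2)).smul (.one A))
  obtain ⟨u, ⟨husa, hu⟩, hdist⟩ := Metric.mem_closure_iff.1 (hrr0 _ hsa) (ε / 4) (by positivity)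
  set r : A := d - (ε / 2) • (1 : A) - u with hr
  rw [dist_eq_norm, ← hr] at hdist
  have hrsa : IsSelfAdjoint r := hsa.sub husa
  have hr1 : r ≤ (ε / 4) • (1 : A) := by
    refine hrsa.le_algebraMap_norm_self.trans ?_
    rw [Algebra.algebraMap_eq_smul_one]
    gcongr
  have hr2 : -((ε / 4) • (1 : A)) ≤ r := by
    refine le_trans ?_ hrsa.neg_algebraMap_norm_le_self
    rw [Algebra.algebraMap_eq_smul_one, neg_le_neg_iff]
    gcongr
  have hdu : d = (ε / 2) • (1 : A) + u + r := by rw [hr]; abel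
  set χ : ℝ → ℝ := fun x => if 0 < x then 1 else 0 with hχ
  have h0 : ∀ x ∈ spectrum ℝ u, x ≠ 0 := by
    rintro x hx rfl
    exact spectrum.zero_notMem ℝ hu hx
  have hcont : ContinuousOn χ (spectrum ℝ u) := by
    intro x hx
    refine ContinuousAt.continuousWithinAt ?_
    rcases lt_or_gt_of_ne (h0 x hx) with hx0 | hx0
    · refine (continuousAt_const (y := (0 : ℝ))).congr ?_
      filter_upwards [Iio_mem_nhds hx0] with y hy
      have : y < 0 := hy
      simp [hχ, this.le]
    · refine (continuousAt_const (y := (1 : ℝ))).congr ?_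
      filter_upwards [Ioi_mem_nhds hx0] with y hy
      have : 0 < y := hy
      simp [hχ, this]
  have hfsa : IsSelfAdjoint (cfc χ u) := cfc_predicate χ u
  have hff : cfc χ u * cfc χ u = cfc χ u := by
    rw [← cfc_mul χ χ u]
    congr 1
    ext x
    simp [hχ]
  have hf : IsStarProjection (cfc χ u) := ⟨hff, hfsa⟩
  refine ⟨cfc χ u, hf, ?_, ε / 4, by positivity, ?_⟩
  · intro hf0
    have hun : u ≤ 0 := by
      have e : u = cfc (fun x => x) u := (cfc_id' ℝ u).symm
      rw [e]
      refine cfc_nonpos _ _ fun x hx => ?_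
      have hsp := cfc_map_spectrum χ u
      by_contra! hx0
      have : χ x ∈ spectrum ℝ (cfc χ u) := by rw [hsp]; exact ⟨x, hx, rfl⟩
      rw [hf0] at this
      exact this (by simp [hχ, hx0, spectrum.mem_resolventSet_iff])
    refine hdε ?_
    calc d = (ε / 2) • (1 : A) + u + r := hdu
      _ ≤ (ε / 2) • (1 : A) + 0 + (ε / 4) • (1 : A) := by gcongr
      _ = (3 * ε / 4) • (1 : A) := by module
      _ ≤ ε • (1 : A) := by gcongr; linarith
  · set f := cfc χ u
    have hfu : 0 ≤ f * u * f := by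
      have e : f * u * f = cfc (fun x => χ x * x * χ x) u := by
        rw [cfc_mul (fun x => χ x * x) χ u, cfc_mul χ (fun x => x) u, cfc_id' ℝ u]
      rw [e]
      refine cfc_nonneg fun x _ => ?_
      by_cases hx : 0 < x <;> simp [hχ, hx, le_of_lt]
    have hfr : -((ε / 4) • f) ≤ f * r * f := by
      have := star_left_conjugate_le_conjugate hr2 f
      simpa [hfsa.star_eq, hff] using this
    calc (ε / 4) • f = (ε / 2) • f + 0 + -((ε / 4) • f) := by module
      _ ≤ (ε / 2) • f + f * u * f + f * r * f := by gcongr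
      _ = f * d * f := by
        rw [hdu]
        simp only [mul_add, add_mul, mul_smul_comm, smul_mul_assoc, mul_one, hff]

theorem add_star_smul_sub_nonpos_of_spectrum_subset
    (hrr0 : ∀ a : A, IsSelfAdjoint a → a ∈ closure {x : A | IsSelfAdjoint x ∧ IsUnit x})
    {x y : A} (h : ∀ a : A, IsSelfAdjoint a → spectrum ℂ (a + y) ⊆ spectrum ℂ (a + x))
    {ω : ℂ} (hω : ω.re ≠ 0) : ω • (y - x) + star (ω • (y - x)) ≤ 0 := by
  by_contra hd
  obtain ⟨f, hf, hf0, δ, hδ, hfd⟩ :=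
    exists_isStarProjection_of_not_nonpos hrr0 (IsSelfAdjoint.add_star_self _) hd
  have hff : f * f = f := hf.isIdempotentElem
  have hfs : star f = f := hf.isSelfAdjoint
  have hf1 : 0 ≤ 1 - f := hf.one_sub.nonneg
  set c : ℝ := δ / 2 with hc
  have hc0 : 0 < c := by positivity
  set X : A := ω • x + star (ω • x) with hX
  have hXsa : IsSelfAdjoint X := IsSelfAdjoint.add_star_self _
  set η : ℂ := ω / ((2 * ω.re : ℝ) : ℂ) with hη
  have hω2 : ((2 * ω.re : ℝ) : ℂ) ≠ 0 := by
    exact_mod_cast mul_ne_zero two_ne_zero hω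
  have hηη : η + star η = 1 := by
    rw [hη, star_div₀, Complex.star_def, Complex.conj_ofReal, ← add_div,
      Complex.add_conj, div_self hω2]
  have hω0 : ω ≠ 0 := by rintro rfl; simp at hω
  set P : A := ω • y - η • X with hP
  have hPd : P + star P = ω • (y - x) + star (ω • (y - x)) := by
    have e : η • X + star η • X = ω • x + star (ω • x) := by rw [← add_smul, hηη, one_smul]
    rw [hP, star_sub, star_smul η, hXsa.star_eq, smul_sub, star_sub, sub_add_sub_comm, e]
    abel
  set W : A := -(P + star P) + 2 • (f * P + star P * f) - c • f with hW
  have hWsa : IsSelfAdjoint W := by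
    simp only [IsSelfAdjoint, hW, star_sub, star_add, star_neg, star_smul, star_mul, star_star, hfs,
      star_trivial]
    abel
  have hfW : c • f ≤ f * W * f := by
    have e : f * W * f = f * (P + star P) * f - c • f := by
      have e1 : f * W * f = -(f * (P + star P) * f) + 2 • (f * f * P * f + f * star P * (f * f))
          - c • (f * f * f) := by
        rw [hW, mul_sub, sub_mul, mul_smul_comm, smul_mul_assoc]
        noncomm_ring
      rw [e1, hff, hff]
      noncomm_ring
    rw [e, hPd]
    calc c • f = δ • f - c • f := by rw [hc]; module
      _ ≤ _ := by gcongr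
  obtain ⟨N, hN⟩ := exists_nonneg_add_smul_one_sub hf hWsa hc0 hfW
  set n : ℝ := max N c
  have hn := hN n (le_max_left _ _)
  have hnc : c ≤ n := le_max_right _ _
  set D : A := n • (1 - f) + c • f with hD
  have hDsa : IsSelfAdjoint D :=
    ((IsSelfAdjoint.all n).smul hf.one_sub.isSelfAdjoint).add
      ((IsSelfAdjoint.all c).smul hf.isSelfAdjoint)
  set a : A := (2 * ω.re)⁻¹ • (-X - D) with ha
  have hasa : IsSelfAdjoint a := (IsSelfAdjoint.all _).smul (hXsa.neg.sub hDsa)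
  have hωa : ω • a = η • (-X - D) := by
    rw [ha, hη, div_eq_mul_inv, mul_smul, ← Complex.ofReal_inv, Complex.coe_smul]
  have hωs : ω • a + star (ω • a) = -X - D := by
    rw [hωa, star_smul, (hXsa.neg.sub hDsa).star_eq, ← add_smul, hηη, one_smul]
  have hx : ω • (a + x) + star (ω • (a + x)) ≤ -(c • (1 : A)) := by
    have e : ω • (a + x) + star (ω • (a + x)) = -D := by
      rw [smul_add, star_add, add_add_add_comm, hωs, ← hX]; abel
    rw [e, neg_le_neg_iff]
    calc c • (1 : A) = c • (1 - f) + c • f := by module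
      _ ≤ D := by rw [hD]; gcongr
  have hy : ∀ z ∈ spectrum ℂ (ω • (a + y)), z.re < 0 := by
    intro z hz
    refine re_neg_of_mem_spectrum hc0 hx ?_
    have e (b : A) : ω⁻¹ * z ∈ spectrum ℂ b ↔ z ∈ spectrum ℂ (ω • b) := by
      simpa [Units.smul_def, mul_inv_cancel_left₀ hω0] using
        (spectrum.smul_mem_smul_iff (a := b) (s := ω⁻¹ * z) (r := Units.mk0 ω hω0)).symm
    exact (e _).1 (h a hasa ((e _).2 hz))
  have hY : ω • (a + y) = P - η • D := by
    rw [smul_add, hωa, hP]; module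
  have hJ : 0 ≤ 1 - 2 • f := by
    refine nonneg_of_mul_add_star_mul_nonpos hy ?_
    have hfD : f * D = c • f := by
      rw [hD, mul_add, mul_smul_comm, mul_smul_comm, mul_sub, hff, mul_one, sub_self, smul_zero,
        zero_add]
    have hDf : D * f = c • f := by
      rw [hD, add_mul, smul_mul_assoc, smul_mul_assoc, sub_mul, hff, one_mul, sub_self, smul_zero,
        zero_add]
    have e : (1 - 2 • f) * (P - η • D) + star (P - η • D) * (1 - 2 • f) = -(W + n • (1 - f)) := by
      have e1 : (1 - 2 • f) * (P - η • D) + star (P - η • D) * (1 - 2 • f) =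
          P + star P - 2 • (f * P + star P * f) - (η + star η) • D
            + 2 • ((η + star η) • (c • f)) := by
        rw [star_sub, star_smul, hDsa.star_eq]
        simp only [two_nsmul, add_mul, mul_add, sub_mul, mul_sub, one_mul, mul_one, smul_mul_assoc,
          mul_smul_comm, hfD, hDf,
          add_smul, smul_add, smul_sub]
        abel
      rw [e1, hηη, one_smul, one_smul, hW, hD]
      module
    rw [hY, e]
    exact neg_nonpos.2 hn
  refine hf0 (le_antisymm ?_ hf.nonneg)
  have := star_left_conjugate_nonneg hJ f
  have e : star f * (1 - 2 • f) * f = -f := by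
    rw [hfs, mul_sub, mul_one, mul_smul_comm, hff, sub_mul, smul_mul_assoc, hff]
    module
  rwa [e, neg_nonneg] at this

theorem eq_of_forall_spectrum_subset
    (hrr0 : ∀ a : A, IsSelfAdjoint a → a ∈ closure {x : A | IsSelfAdjoint x ∧ IsUnit x})
    {x y : A} (h : ∀ a : A, IsSelfAdjoint a → spectrum ℂ (a + y) ⊆ spectrum ℂ (a + x)) :
    y = x := by
  have key {ω : ℂ} (hω : ω.re ≠ 0) : ω • (y - x) + star (ω • (y - x)) = 0 := by
    refine le_antisymm (add_star_smul_sub_nonpos_of_spectrum_subset hrr0 h hω) ?_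
    have := add_star_smul_sub_nonpos_of_spectrum_subset hrr0 h (ω := -ω) (by simpa using hω)
    rwa [neg_smul, star_neg, ← neg_add, neg_nonpos] at this
  have h1 := key (ω := 1) (by simp)
  have h2 := key (ω := 1 + Complex.I) (by simp)
  rw [one_smul, add_eq_zero_iff_neg_eq] at h1
  rw [star_smul, ← h1, smul_neg, ← sub_eq_add_neg, ← sub_smul] at h2
  have h3 : (1 + Complex.I) - star (1 + Complex.I) ≠ 0 := by
    simp [Complex.ext_iff]
  exact sub_eq_zero.1 ((smul_eq_zero.1 h2).resolve_left h3)

end CStar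

section Jordan

variable {A B : Type*} [Ring A] [Algebra ℂ A] [Ring B] [Algebra ℂ B] {S : A →ₗ[ℂ] B}

theorem map_mul_mul_self_of_map_mul_self (hS : ∀ x, S (x * x) = S x * S x) (x y : A) :
    S (x * y * x) = S x * S y * S x := by
  have hadd (x y : A) : S (x * y + y * x) = S x * S y + S y * S x := by
    have h := hS (x + y)
    have e : (x + y) * (x + y) = x * x + (x * y + y * x) + y * y := by noncomm_ring
    rw [e, map_add, map_add, hS, hS, map_add S x y] at h
    have e' : (S x + S y) * (S x + S y) = S x * S x + (S x * S y + S y * S x) + S y * S y := by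
      noncomm_ring
    rw [e'] at h
    exact add_left_cancel (add_right_cancel h)
  have e : (2 : ℂ) • (x * y * x) =
      (x * (x * y + y * x) + (x * y + y * x) * x) - (x * x * y + y * (x * x)) := by
    rw [ofNat_smul_eq_nsmul]; noncomm_ring
  have h := congrArg S e
  rw [map_smul, map_sub, hadd, hadd, hadd, hS] at h
  refine smul_right_injective B (two_ne_zero (α := ℂ)) ?_
  simp only [h, ofNat_smul_eq_nsmul]
  noncomm_ring

theorem IsUnit.map_of_map_mul_self (hS1 : S 1 = 1) (hS : ∀ x, S (x * x) = S x * S x) {x : A}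
    (hx : IsUnit x) : IsUnit (S x) := by
  obtain ⟨u, rfl⟩ := hx
  have h : S u * S (↑u⁻¹ * ↑u⁻¹) * S u = 1 := by
    rw [← map_mul_mul_self_of_map_mul_self hS, ← hS1]
    simp
  exact isUnit_iff_exists_and_exists.2 ⟨⟨_, by rw [← mul_assoc]; exact h⟩, ⟨_, h⟩⟩

theorem spectrum_map_subset_of_map_mul_self (hS1 : S 1 = 1) (hS : ∀ x, S (x * x) = S x * S x)
    (x : A) : spectrum ℂ (S x) ⊆ spectrum ℂ x := by
  intro z hz hu
  refine hz ?_
  have := IsUnit.map_of_map_mul_self hS1 hS hu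
  rwa [map_sub, Algebra.algebraMap_eq_smul_one, map_smul, hS1,
    ← Algebra.algebraMap_eq_smul_one] at this

end Jordan

/-- With `T`, `S`, `R` as in the paper (`R = T⁻¹ ∘ S`), for every `λ ∈ ℂ` and every
idempotent `p ∈ A`, the element `λ·Rp + (1 − λ)·(−i·R(ip))` is an idempotent. -/
theorem convex_combination_of_idempotents
    {A : Type*} [NormedRing A] [StarRing A] [CStarRing A] [NormedAlgebra ℂ A]
    [CompleteSpace A] [StarModule ℂ A]
    (hrr0 : ∀ a : A, IsSelfAdjoint a → a ∈ closure {x : A | IsSelfAdjoint x ∧ IsUnit x})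
    {B : Type*} [NormedRing B] [NormedAlgebra ℂ B] [CompleteSpace B]
    (T : A → B)
    (hsurj : Function.Surjective T)
    (hadd : ∀ x y : A, T (x + y) = T x + T y)
    (hspec : ∀ x : A, spectrum ℂ (T x) = spectrum ℂ x)
    (S : A →ₗ[ℂ] B) (hS1 : S 1 = 1) (hSj : ∀ x : A, S (x * x) = S x * S x)
    (hST : ∀ a : A, IsSelfAdjoint a → S a = T a)
    (R : A → A) (hR : ∀ x : A, T (R x) = S x) :
    ∀ (lam : ℂ) (p : A), IsIdempotentElem p →
      IsIdempotentElem (lam • R p + (1 - lam) • (-(Complex.I • R (Complex.I • p)))) := by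
  intro lam p hp
  let : CStarAlgebra A := {}
  let : PartialOrder A := CStarAlgebra.spectralOrder A
  have : StarOrderedRing A := CStarAlgebra.spectralOrderedRing A
  have hRid (x : A) : R x = x := by
    refine eq_of_forall_spectrum_subset hrr0 fun a ha => ?_
    rw [← hspec, hadd, hR, ← hST a ha, ← map_add]
    exact spectrum_map_subset_of_map_mul_self hS1 hSj (a + x)
  have e : lam • R p + (1 - lam) • (-(Complex.I • R (Complex.I • p))) = p := by
    rw [hRid, hRid, smul_smul, Complex.I_mul_I]
    module
  rwa [e]
end

section
/- Let A be a unital C*-algebra of real rank zero, let B be a complex unital Banach algebra, let T : A → B be a surjective additive map with σ(Tx) = σ(x) for all x ∈ A (so T is bijective), and let S : A → B be a unital Jordan homomorphism with Sa = Ta for every self-adjoint a ∈ A. Put R = T⁻¹ ∘ S : A → A, define R̃ : A → A by R̃x = ½(Rx − i·R(ix)) and W : A → A by Wx = ½(R(x*) + i·R(i·x*)). Then R̃x + Wx = x for all x ∈ A, and for every α ∈ ℂ the map R̃ + αW is a Jordan homomorphism, i.e. (R̃ + αW)(x²) = ((R̃ + αW)x)² for all x ∈ A. -/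
section CStarAlgebra

open Complex ComplexStarModule

theorem isUnit_map_of_jordan {A B : Type*} [Ring A] [Algebra ℂ A] [Ring B] [Algebra ℂ B]
    (S : A →ₗ[ℂ] B) (hS1 : S 1 = 1) (hSj : ∀ x : A, S (x * x) = S x * S x) {x : A}
    (hx : IsUnit x) : IsUnit (S x) := by
  have hlin : ∀ x y : A, S (x * y + y * x) = S x * S y + S y * S x := by
    intro x y
    have h := hSj (x + y)
    simp only [add_mul, mul_add, map_add, hSj] at h
    rw [map_add]
    have h' : S x * S x + S (y * x) + (S (x * y) + S y * S y) =
        S x * S x + S y * S x + (S x * S y + S y * S y) := h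
    have e1 : S (x * y) + S (y * x) = S x * S x + S (y * x) + (S (x * y) + S y * S y)
        - S x * S x - S y * S y := by abel
    rw [e1, h']
    abel
  have htri : ∀ x y : A, S (x * y * x) = S x * S y * S x := by
    intro x y
    have h1 := hlin x (x * y + y * x)
    have h2 := hlin (x * x) y
    rw [hlin x y] at h1
    rw [hSj] at h2
    have e1 : x * (x * y + y * x) + (x * y + y * x) * x =
        (x * x * y + y * (x * x)) + (2 : ℂ) • (x * y * x) := by
      rw [two_smul]; noncomm_ring
    rw [e1, map_add, h2, map_smul] at h1
    have h3 : (2 : ℂ) • S (x * y * x) = (2 : ℂ) • (S x * S y * S x) := by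
      rw [← add_right_inj (S x * S x * S y + S y * (S x * S x)), h1, two_smul]
      noncomm_ring
    exact smul_right_injective B (two_ne_zero' ℂ) h3
  obtain ⟨u, rfl⟩ := hx
  have h := htri u (↑u⁻¹ * ↑u⁻¹)
  have e : (u : A) * (↑u⁻¹ * ↑u⁻¹) * u = 1 := by simp
  rw [e, hS1] at h
  exact isUnit_iff_exists_and_exists.2 ⟨⟨_, by rw [← mul_assoc]; exact h.symm⟩, ⟨_, h.symm⟩⟩

theorem exists_mem_spectrum_smul_add_of_norm_le {A : Type*} [NormedRing A] [NormedAlgebra ℂ A]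
    [CompleteSpace A] {q : A} (hq : IsIdempotentElem q) (hq0 : q ≠ 0) {r ρ : ℝ} (hρ : 0 < ρ)
    (hr : 2 * ρ ≤ r) :
    ∃ η > 0, ∀ w : A, ‖w‖ ≤ η → ∃ z ∈ spectrum ℂ ((r : ℂ) • (1 - q) + w), ‖z‖ ≤ ρ := by
  have hqn : 0 < ‖q‖ := norm_pos_iff.2 hq0
  set N : ℝ := (‖q‖ + ‖1 - q‖) / ρ with hN
  have hNpos : 0 < N := by positivity
  refine ⟨min (1 / (2 * N)) (‖q‖ / (4 * ρ * N ^ 2)), by positivity, fun w hw => ?_⟩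
  by_contra! hcon
  set x : A := (r : ℂ) • (1 - q) + w with hx
  have hres : ∀ z : ℂ, ‖z‖ ≤ ρ → z ∈ resolventSet ℂ x := fun z hz =>
    spectrum.notMem_iff.1 fun h => (hcon z h).not_ge hz
  have hzr : ∀ z : ℂ, ‖z‖ ≤ ρ → ρ ≤ ‖z - r‖ := by
    intro z hz
    have h1 := norm_sub_norm_le (r : ℂ) z
    rw [norm_sub_rev, norm_real, Real.norm_of_nonneg (by linarith)] at h1
    linarith
  have hzr0 : ∀ z : ℂ, ‖z‖ ≤ ρ → z - r ≠ 0 := fun z hz =>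
    norm_pos_iff.1 (hρ.trans_le (hzr z hz))
  set g : ℂ → A := fun z => z • resolvent x z - q - (z / (z - r)) • (1 - q) with hg
  have hdiff : DifferentiableOn ℂ g (Metric.closedBall 0 ρ) := by
    intro z hz
    have hz' : ‖z‖ ≤ ρ := by simpa using hz
    have h1 := (spectrum.hasDerivAt_resolvent_const_left (hres z hz')).differentiableAt
    have h2 := hzr0 z hz'
    have : DifferentiableAt ℂ g z := by
      simp only [hg]
      fun_prop (disch := assumption)
    exact this.differentiableWithinAt
  have hbd : ∀ z ∈ frontier (Metric.ball (0 : ℂ) ρ), ‖g z‖ ≤ ‖q‖ / 2 := by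
    intro z hz
    rw [frontier_ball _ hρ.ne'] at hz
    have hz' : ‖z‖ = ρ := by simpa using hz
    have hz0 : z ≠ 0 := norm_pos_iff.1 (hz' ▸ hρ)
    have hzr1 := hzr0 z hz'.le
    have hu : IsUnit (algebraMap ℂ A z - x) := hres z hz'.le
    set y := resolvent x z with hy
    set y₀ : A := z⁻¹ • q + (z - r)⁻¹ • (1 - q) with hy₀
    have hyx : y * (algebraMap ℂ A z - x) = 1 := Ring.inverse_mul_cancel _ hu
    have hxy₀ : (algebraMap ℂ A z - (r : ℂ) • (1 - q)) * y₀ = 1 := by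
      have e1 : algebraMap ℂ A z - (r : ℂ) • (1 - q) = z • q + (z - r) • (1 - q) := by
        rw [Algebra.algebraMap_eq_smul_one]; module
      have e2 : q * (1 - q) = 0 := by rw [mul_sub, mul_one, hq.eq, sub_self]
      have e3 : (1 - q) * q = 0 := by rw [sub_mul, one_mul, hq.eq, sub_self]
      rw [e1, hy₀]
      simp only [mul_add, add_mul, smul_mul_smul_comm, hq.eq, hq.one_sub.eq, e2, e3]
      rw [mul_inv_cancel₀ hz0, mul_inv_cancel₀ hzr1]
      simp
    have hsub : y - y₀ = y * w * y₀ := by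
      have : w = (algebraMap ℂ A z - (r : ℂ) • (1 - q)) - (algebraMap ℂ A z - x) := by
        rw [hx]; abel
      rw [this, mul_sub, sub_mul, hyx, mul_assoc, hxy₀]
      simp
    have hN0 : ‖y₀‖ ≤ N := by
      have h1 : ‖z⁻¹ • q‖ ≤ ρ⁻¹ * ‖q‖ := by rw [norm_smul, norm_inv, hz']
      have h2 : ‖(z - r)⁻¹ • (1 - q)‖ ≤ ρ⁻¹ * ‖1 - q‖ := by
        rw [norm_smul, norm_inv]
        have := hzr z hz'.le
        gcongr
      calc ‖y₀‖ ≤ _ := norm_add_le _ _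
        _ ≤ ρ⁻¹ * ‖q‖ + ρ⁻¹ * ‖1 - q‖ := add_le_add h1 h2
        _ = N := by rw [hN]; ring
    have hw1 : ‖w‖ * N ≤ 1 / 2 := by
      have := hw.trans (min_le_left _ _)
      rw [le_div_iff₀ (by positivity)] at this
      linarith
    have hw2 : ρ * (2 * N * ‖w‖ * N) ≤ ‖q‖ / 2 := by
      have := hw.trans (min_le_right _ _)
      rw [le_div_iff₀ (by positivity)] at this
      linarith
    have h3 : ‖y * w * y₀‖ ≤ ‖y‖ * ‖w‖ * N := by
      refine (norm_mul_le _ _).trans ?_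
      gcongr
      exact norm_mul_le _ _
    have hyN : ‖y‖ ≤ 2 * N := by
      have h1 : ‖y‖ ≤ ‖y - y₀‖ + ‖y₀‖ := by simpa using norm_add_le (y - y₀) y₀
      rw [hsub] at h1
      have : ‖y‖ * ‖w‖ * N ≤ ‖y‖ * (1 / 2) := by
        rw [mul_assoc]; gcongr
      linarith
    have hgz : g z = z • (y - y₀) := by
      simp only [hg, hy₀, smul_sub, smul_add, smul_smul, mul_inv_cancel₀ hz0, one_smul]
      rw [div_eq_mul_inv]
      abel
    rw [hgz, hsub, norm_smul, hz']
    calc ρ * ‖y * w * y₀‖ ≤ ρ * (2 * N * ‖w‖ * N) := by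
          gcongr
          exact h3.trans (by gcongr)
      _ ≤ _ := hw2
  have hdc : DiffContOnCl ℂ g (Metric.ball 0 ρ) := hdiff.diffContOnCl_ball subset_rfl
  have := Complex.norm_le_of_forall_mem_frontier_norm_le Metric.isBounded_ball hdc hbd
    (subset_closure (Metric.mem_ball_self hρ))
  simp only [hg, zero_smul, zero_div, sub_zero, zero_sub, norm_neg] at this
  linarith

variable {A : Type*} [CStarAlgebra A]

theorem norm_conj_imag_le {a d : A} (ha : IsSelfAdjoint a) (hd : IsSelfAdjoint d) (e : A) :
    ‖star e * d * e‖ ≤ ‖star e * (a + I • d) * e‖ := by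
  have h1 : IsSelfAdjoint (star e * a * e) := ha.conjugate' e
  have h2 : IsSelfAdjoint (star e * d * e) := hd.conjugate' e
  have h3 : star e * (a + I • d) * e = star e * a * e + I • (star e * d * e) := by
    simp [mul_add, add_mul]
  have h4 : ((ℑ (star e * (a + I • d) * e) : selfAdjoint A) : A) = star e * d * e := by
    rw [h3, map_add, h1.imaginaryPart, imaginaryPart_I_smul, zero_add, h2.coe_realPart]
  calc _ = ‖(ℑ (star e * (a + I • d) * e) : selfAdjoint A)‖ := by rw [← h4]; rfl
    _ ≤ _ := imaginaryPart.norm_le _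

theorem norm_star_mul_one_mul_self {e : A} : ‖star e * 1 * e‖ = ‖e‖ ^ 2 := by
  rw [mul_one, CStarRing.norm_star_mul_self, sq]

theorem continuousOn_div_abs_spectrum {g : A} (hu : IsUnit g) :
    ContinuousOn (fun t : ℝ => t / |t|) (spectrum ℝ g) := by
  have : ∀ t ∈ spectrum ℝ g, |t| ≠ 0 := by
    intro t ht h
    rw [abs_eq_zero] at h
    subst h
    exact (spectrum.zero_notMem_iff ℝ).2 hu ht
  fun_prop (disch := assumption)

theorem ne_zero_of_mem_spectrum {g : A} (hu : IsUnit g) {t : ℝ} (ht : t ∈ spectrum ℝ g) :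
    t ≠ 0 := by
  rintro rfl
  exact (spectrum.zero_notMem_iff ℝ).2 hu ht

theorem nontrivial_of_mem_spectrum {a : A} {t : ℝ} (ht : t ∈ spectrum ℝ a) : Nontrivial A := by
  by_contra h
  rw [not_nontrivial_iff_subsingleton] at h
  simp [spectrum.of_subsingleton] at ht

/-- The spectral projection of an invertible self-adjoint element for the positive half-line. -/
noncomputable def posProj (g : A) : A := (2⁻¹ : ℝ) • (1 + cfc (fun t : ℝ => t / |t|) g)

theorem two_smul_posProj_sub_one (g : A) :
    posProj g + posProj g - 1 = cfc (fun t : ℝ => t / |t|) g := by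
  rw [posProj]; module

theorem exists_isUnit_norm_sub_lt
    (hrr0 : ∀ a : A, IsSelfAdjoint a → a ∈ closure {x : A | IsSelfAdjoint x ∧ IsUnit x})
    {a : A} (ha : IsSelfAdjoint a) {ε : ℝ} (hε : 0 < ε) :
    ∃ g : A, IsSelfAdjoint g ∧ IsUnit g ∧ ‖a - g‖ < ε := by
  obtain ⟨g, ⟨h1, h2⟩, h3⟩ := Metric.mem_closure_iff.1 (hrr0 a ha) ε hε
  exact ⟨g, h1, h2, by rwa [← dist_eq_norm]⟩

theorem isStarProjection_posProj {g : A} (hg : IsSelfAdjoint g) (hu : IsUnit g) :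
    IsStarProjection (posProj g) := by
  have hc := continuousOn_div_abs_spectrum hu
  set s := cfc (fun t : ℝ => t / |t|) g with hs
  have hsa : IsSelfAdjoint s := cfc_predicate _ g
  have hss : s * s = 1 := by
    rw [hs, ← cfc_mul _ _ g hc hc, ← cfc_one ℝ g]
    refine cfc_congr fun t ht => ?_
    have := ne_zero_of_mem_spectrum hu ht
    have h2 : |t| ≠ 0 := by simpa using this
    have h3 := abs_mul_abs_self t
    simp only [Pi.one_apply]
    field_simp
    nlinarith
  refine ⟨?_, ?_⟩
  · rw [IsIdempotentElem, posProj, ← hs, smul_mul_smul_comm]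
    simp only [mul_add, add_mul, hss, mul_one, one_mul]
    module
  · exact (IsSelfAdjoint.all (2⁻¹ : ℝ)).smul ((IsSelfAdjoint.one A).add hsa)

theorem norm_two_smul_sub_le {g : A} (hg : IsSelfAdjoint g) (hu : IsUnit g) (h1 : ‖g‖ ≤ 1) :
    ‖g + g - (posProj g + posProj g - 1)‖ ≤ 1 := by
  have hc := continuousOn_div_abs_spectrum hu
  have : g + g - (posProj g + posProj g - 1) = cfc (fun t : ℝ => t + t - t / |t|) g := by
    rw [two_smul_posProj_sub_one, cfc_sub (fun t => t + t) _ g, cfc_add g (fun t => t) _,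
      cfc_id' ℝ g]
  rw [this]
  have : Nontrivial A ∨ Subsingleton A := (subsingleton_or_nontrivial A).symm
  rcases this with _ | _
  swap
  · rw [Subsingleton.elim (cfc _ g) 0]; simp
  refine norm_cfc_le zero_le_one fun t ht => ?_
  have h2 := ne_zero_of_mem_spectrum hu ht
  have h3 := (spectrum.norm_le_norm_of_mem ht).trans h1
  rw [Real.norm_eq_abs, abs_le] at h3 ⊢
  rcases lt_or_gt_of_ne h2 with h | h
  · rw [abs_of_neg h, div_neg, div_self h2]
    constructor <;> linarith
  · rw [abs_of_pos h, div_self h2]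
    constructor <;> linarith

variable [PartialOrder A] [StarOrderedRing A]

theorem exists_norm_conj_le_of_not_isUnit {y : A} (hy : 0 ≤ y) (hu : ¬ IsUnit y) {ε : ℝ}
    (hε : 0 < ε) : ∃ e : A, IsSelfAdjoint e ∧ ‖e‖ = 1 ∧ ‖e * y * e‖ ≤ ε := by
  have : Nontrivial A := by
    by_contra h
    rw [not_nontrivial_iff_subsingleton] at h
    exact hu (isUnit_of_subsingleton y)
  have hsa : IsSelfAdjoint y := .of_nonneg hy
  have h0 : (0 : ℝ) ∈ spectrum ℝ y := (spectrum.zero_mem_iff ℝ).2 hu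
  have hnn : ∀ t ∈ spectrum ℝ y, 0 ≤ t := fun t ht => spectrum_nonneg_of_nonneg hy ht
  set f : ℝ → ℝ := fun t => max 0 (1 - t / ε) with hf
  have hfc : Continuous f := by fun_prop
  refine ⟨cfc f y, cfc_predicate f y, le_antisymm ?_ ?_, ?_⟩
  · refine norm_cfc_le zero_le_one fun t ht => ?_
    have := div_nonneg (hnn t ht) hε.le
    rw [Real.norm_of_nonneg (le_max_left _ _)]
    exact max_le zero_le_one (by linarith)
  · have h1 : f 0 ∈ spectrum ℝ (cfc f y) := by
      rw [cfc_map_spectrum f y]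
      exact ⟨0, h0, rfl⟩
    have := spectrum.norm_le_norm_of_mem h1
    simpa [hf] using this
  · have : cfc f y * y * cfc f y = cfc (fun t => f t * t * f t) y := by
      rw [cfc_mul (fun t => f t * t) f y, cfc_mul f (fun t => t) y, cfc_id' ℝ y]
    rw [this]
    refine norm_cfc_le hε.le fun t ht => ?_
    have h2 := hnn t ht
    have h3 : 0 ≤ f t := le_max_left _ _
    rw [Real.norm_of_nonneg (by positivity)]
    rcases le_total (1 - t / ε) 0 with h | h
    · simp [hf, max_eq_left h, hε.le]
    · have h4 : f t = 1 - t / ε := max_eq_right h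
      have h5 : t / ε ≤ 1 := by linarith
      have h6 : t ≤ ε := by rwa [div_le_one hε] at h5
      have h7 : f t ≤ 1 := by rw [h4]; linarith [div_nonneg h2 hε.le]
      calc f t * t * f t ≤ 1 * t * 1 := by gcongr
        _ ≤ ε := by linarith

theorem exists_norm_mul_le_of_not_isUnit {x : A} (hu : ¬ IsUnit x) {ε : ℝ}
    (hε : 0 < ε) : ∃ e : A, ‖e‖ = 1 ∧ (‖x * e‖ ≤ ε ∨ ‖star x * e‖ ≤ ε) := by
  have key : ∀ z : A, ¬ IsUnit (star z * z) → ∃ e : A, ‖e‖ = 1 ∧ ‖z * e‖ ≤ ε := by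
    intro z hz
    obtain ⟨e, he, he1, he2⟩ := exists_norm_conj_le_of_not_isUnit (star_mul_self_nonneg z) hz
      (pow_pos hε 2)
    refine ⟨e, he1, ?_⟩
    have : ‖z * e‖ ^ 2 ≤ ε ^ 2 := by
      rw [sq, ← CStarRing.norm_star_mul_self, star_mul, he.star_eq]
      simpa only [mul_assoc] using he2
    exact le_of_sq_le_sq this hε.le
  by_cases h1 : IsUnit (star x * x)
  · by_cases h2 : IsUnit (star (star x) * star x)
    · rw [star_star] at h2
      obtain ⟨u, hu1⟩ := h1
      obtain ⟨v, hv1⟩ := h2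
      refine absurd (isUnit_iff_exists_and_exists.2 ⟨⟨star x * ↑v⁻¹, ?_⟩, ⟨↑u⁻¹ * star x, ?_⟩⟩) hu
      · rw [← mul_assoc, ← hv1, Units.mul_inv]
      · rw [mul_assoc, ← hu1, Units.inv_mul]
    · obtain ⟨e, h, h'⟩ := key _ h2
      exact ⟨e, h, .inr h'⟩
  · obtain ⟨e, h, h'⟩ := key _ h1
    exact ⟨e, h, .inl h'⟩

theorem exists_of_not_isUnit_add_I_smul {a d : A} (ha : IsSelfAdjoint a) (hd : IsSelfAdjoint d)
    (hu : ¬ IsUnit (a + I • d)) {ε : ℝ} (hε : 0 < ε) :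
    ∃ e : A, ‖e‖ = 1 ∧ ‖star e * d * e‖ ≤ ε ∧ ‖a * e‖ ≤ ε + ‖d * e‖ := by
  obtain ⟨e, he, h⟩ := exists_norm_mul_le_of_not_isUnit hu hε
  have hst : star (a + I • d) = a + I • (-d) := by
    simp [ha.star_eq, hd.star_eq]
  have key : ∀ d' : A, IsSelfAdjoint d' → ‖(a + I • d') * e‖ ≤ ε →
      ‖star e * d' * e‖ ≤ ε ∧ ‖a * e‖ ≤ ε + ‖d' * e‖ := by
    intro d' hd' h
    refine ⟨(norm_conj_imag_le ha hd' e).trans ?_, ?_⟩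
    · rw [mul_assoc]
      refine (norm_mul_le _ _).trans ?_
      rwa [norm_star, he, one_mul]
    · have : a * e = (a + I • d') * e - I • (d' * e) := by simp [add_mul]
      rw [this]
      refine (norm_sub_le _ _).trans ?_
      rw [norm_smul, norm_I, one_mul]
      gcongr
  refine ⟨e, he, ?_⟩
  rcases h with h | h
  · exact key d hd h
  · rw [hst] at h
    simpa using key (-d) hd.neg h

theorem isUnit_add_I_smul {a d : A} (ha : IsSelfAdjoint a) {δ : ℝ} (hδ : 0 < δ)
    (hd : algebraMap ℝ A δ ≤ d) : IsUnit (a + I • d) := by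
  by_contra hu
  have hd' : IsSelfAdjoint d := .of_ge hd (IsSelfAdjoint.algebraMap A (IsSelfAdjoint.all δ))
  obtain ⟨e, he, h, -⟩ := exists_of_not_isUnit_add_I_smul ha hd' hu (half_pos hδ)
  have h1 : star e * algebraMap ℝ A δ * e ≤ star e * d * e := star_left_conjugate_le_conjugate hd e
  have h0 : 0 ≤ star e * algebraMap ℝ A δ * e :=
    star_left_conjugate_nonneg (by rw [Algebra.algebraMap_eq_smul_one]; exact smul_nonneg hδ.le zero_le_one) e
  have h2 := CStarAlgebra.norm_le_norm_of_nonneg_of_le h0 h1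
  have h3 : ‖star e * algebraMap ℝ A δ * e‖ = δ := by
    rw [Algebra.algebraMap_eq_smul_one, mul_smul_comm, smul_mul_assoc, norm_smul,
      norm_star_mul_one_mul_self, he, Real.norm_of_nonneg hδ.le]
    simp
  linarith

theorem norm_mul_sq_le_norm_conj {d : A} (h0 : 0 ≤ d) (h1 : d ≤ 1) (e : A) :
    ‖d * e‖ ^ 2 ≤ ‖star e * d * e‖ := by
  have hsa : IsSelfAdjoint d := .of_nonneg h0
  have hdd : d * d ≤ d := by
    simpa [sq] using CStarAlgebra.pow_antitone h0 h1 one_le_two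
  have h2 : ‖d * e‖ ^ 2 = ‖star e * (d * d) * e‖ := by
    rw [sq, ← CStarRing.norm_star_mul_self, star_mul, hsa.star_eq]
    simp only [mul_assoc]
  rw [h2]
  refine CStarAlgebra.norm_le_norm_of_nonneg_of_le ?_ (star_left_conjugate_le_conjugate hdd e)
  exact star_left_conjugate_nonneg (hsa.mul_self_nonneg) e

theorem le_zero_of_posProj_eq_zero {g : A} (hg : IsSelfAdjoint g) (hu : IsUnit g)
    (h : posProj g = 0) : g ≤ 0 := by
  have hc := continuousOn_div_abs_spectrum hu
  rw [← neg_nonneg, StarOrderedRing.nonneg_iff_spectrum_nonneg (R := ℝ) _ hg.neg]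
  intro t ht
  have := nontrivial_of_mem_spectrum ht
  rw [← spectrum.neg_eq, Set.mem_neg] at ht
  by_contra! htneg
  have h1 := two_smul_posProj_sub_one g
  have h2 : (1 : ℝ) ∈ spectrum ℝ (cfc (fun t : ℝ => t / |t|) g) := by
    rw [cfc_map_spectrum _ g]
    refine ⟨-t, ht, ?_⟩
    have : 0 < -t := by linarith
    simp only [abs_of_pos this]
    exact div_self this.ne'
  rw [← h1, h] at h2
  have h3 : (0 : A) + 0 - 1 = algebraMap ℝ A (-1) := by simp
  rw [h3, spectrum.scalar_eq] at h2
  norm_num at h2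

theorem smul_one_sub_posProj_add_nonneg {g : A} (hg : IsSelfAdjoint g) (hu : IsUnit g) {r : ℝ}
    (hr : ‖g‖ ≤ r) : 0 ≤ r • (1 - posProj g) + g := by
  have hc := continuousOn_div_abs_spectrum hu
  have : r • (1 - posProj g) + g = cfc (fun t : ℝ => r / 2 * (1 - t / |t|) + t) g := by
    rw [cfc_add g (fun t => r / 2 * (1 - t / |t|)) _, cfc_const_mul _ _ g,
      cfc_sub (fun _ => (1 : ℝ)) _ g, cfc_const_one ℝ g, cfc_id' ℝ g, posProj]
    module
  rw [this]
  refine cfc_nonneg fun t ht => ?_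
  have := nontrivial_of_mem_spectrum ht
  have h2 := ne_zero_of_mem_spectrum hu ht
  have h3 := (spectrum.norm_le_norm_of_mem ht).trans hr
  rw [Real.norm_eq_abs, abs_le] at h3
  rcases lt_or_gt_of_ne h2 with h | h
  · rw [abs_of_neg h, div_neg, div_self h2]
    linarith
  · rw [abs_of_pos h, div_self h2]
    linarith

theorem nonpos_of_spectrum_add_I_smul_subset
    (hrr0 : ∀ a : A, IsSelfAdjoint a → a ∈ closure {x : A | IsSelfAdjoint x ∧ IsUnit x})
    {b k : A} (hb : IsSelfAdjoint b) (hk : IsSelfAdjoint k)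
    (h : ∀ m : ℕ, 0 < m → ∀ x : A, IsSelfAdjoint x →
      spectrum ℂ (x + I • ((m : ℝ)⁻¹ • k)) ⊆ spectrum ℂ (x + b + I • ((m : ℝ)⁻¹ • k))) :
    b ≤ 0 := by
  by_contra hb0
  obtain ⟨M, hMb, hM⟩ : ∃ M ∈ spectrum ℝ b, 0 < M := by
    by_contra! hcon
    apply hb0
    simpa using le_algebraMap_of_spectrum_le (r := 0) hcon (ha := hb)
  have := nontrivial_of_mem_spectrum hMb
  have hsc : ∀ t : ℝ, IsSelfAdjoint (algebraMap ℝ A t) := fun t =>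
    IsSelfAdjoint.algebraMap A (IsSelfAdjoint.all t)
  obtain ⟨g, hg, hgu, hgn⟩ := exists_isUnit_norm_sub_lt hrr0 (hb.sub (hsc (M / 2)))
    (show 0 < M / 8 by positivity)
  set v := b - algebraMap ℝ A (M / 2) - g with hv
  have hvsa : IsSelfAdjoint v := (hb.sub (hsc _)).sub hg
  have hv1 : v ≤ algebraMap ℝ A (M / 8) :=
    hvsa.le_algebraMap_norm_self.trans (algebraMap_mono A hgn.le)
  have hv2 : -algebraMap ℝ A (M / 8) ≤ v :=
    (neg_le_neg (algebraMap_mono A hgn.le)).trans hvsa.neg_algebraMap_norm_le_self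
  have hbv : b = algebraMap ℝ A (M / 2) + g + v := by rw [hv]; abel
  have hq := isStarProjection_posProj hg hgu
  have hq0 : posProj g ≠ 0 := by
    intro h0
    have h1 := le_zero_of_posProj_eq_zero hg hgu h0
    have h2 : b ≤ algebraMap ℝ A (5 * M / 8) := by
      calc b = algebraMap ℝ A (M / 2) + g + v := hbv
        _ ≤ algebraMap ℝ A (M / 2) + 0 + algebraMap ℝ A (M / 8) := by gcongr
        _ = _ := by rw [add_zero, ← map_add]; congr 1; ring
    have := (le_algebraMap_iff_spectrum_le (ha := hb)).1 h2 M hMb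
    linarith
  set q := posProj g
  set r := ‖g‖ + M with hr
  obtain ⟨η, hη, hper⟩ := exists_mem_spectrum_smul_add_of_norm_le hq.isIdempotentElem hq0
    (show 0 < M / 4 by positivity) (show 2 * (M / 4) ≤ r by linarith [norm_nonneg g])
  obtain ⟨m, hm⟩ := exists_nat_gt (‖k‖ / η)
  have hm0 : (0 : ℝ) < m := lt_of_le_of_lt (by positivity) hm
  set k' := (m : ℝ)⁻¹ • k with hk'
  have hk'sa : IsSelfAdjoint k' := (IsSelfAdjoint.all ((m : ℝ)⁻¹)).smul hk
  have hk'n : ‖I • k'‖ ≤ η := by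
    rw [norm_smul, norm_I, one_mul, hk', norm_smul, norm_inv, Real.norm_of_nonneg hm0.le,
      inv_mul_le_iff₀ hm0]
    rw [div_lt_iff₀ hη] at hm
    linarith
  obtain ⟨z, hz, hzn⟩ := hper _ hk'n
  have hxsa : IsSelfAdjoint (r • (1 - q)) :=
    (IsSelfAdjoint.all r).smul ((IsSelfAdjoint.one A).sub hq.isSelfAdjoint)
  have hcast : (r : ℂ) • (1 - q) = r • (1 - q) := Complex.coe_smul r _
  rw [hcast] at hz
  have hz2 := h m (by exact_mod_cast hm0) _ hxsa hz
  rw [spectrum.mem_iff] at hz2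
  apply hz2
  set a := r • (1 - q) + b with ha
  have hle : algebraMap ℝ A (M / 8) ≤ a - algebraMap ℝ A z.re := by
    have h1 := smul_one_sub_posProj_add_nonneg hg hgu (r := r) (by linarith)
    have h2 : z.re ≤ M / 4 := (Complex.re_le_norm z).trans hzn
    have h3 := algebraMap_mono A h2
    have h4 : a = (r • (1 - q) + g) + algebraMap ℝ A (M / 2) + v := by
      rw [ha, hbv]; abel
    have h5 : algebraMap ℝ A (M / 8) =
        0 + algebraMap ℝ A (M / 2) + - algebraMap ℝ A (M / 8) - algebraMap ℝ A (M / 4) := by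
      simp only [← map_neg, ← map_add, ← map_sub, zero_add]
      congr 1; ring
    rw [h4, h5]
    gcongr
  have hu := isUnit_add_I_smul ((hsc z.im).sub hk'sa) (show 0 < M / 8 by positivity) hle
  have heq : algebraMap ℂ A z - (a + I • k') = Units.mk0 I I_ne_zero •
      (algebraMap ℝ A z.im - k' + I • (a - algebraMap ℝ A z.re)) := by
    rw [Units.smul_def, Units.val_mk0, smul_add, smul_smul, I_mul_I]
    conv_lhs => rw [← re_add_im z]
    simp only [Algebra.algebraMap_eq_smul_one, ← Complex.coe_smul]
    module
  rw [heq]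
  exact hu.smul _

omit [PartialOrder A] [StarOrderedRing A] in
theorem eq_self_of_forall_isStarProjection
    (hrr0 : ∀ a : A, IsSelfAdjoint a → a ∈ closure {x : A | IsSelfAdjoint x ∧ IsUnit x})
    (C : A →+ A) (hC : ∀ x : A, IsSelfAdjoint x → ‖C x‖ ≤ ‖x‖)
    (hp : ∀ p : A, IsStarProjection p → C p = p) {x : A} (hx : IsSelfAdjoint x) : C x = x := by
  have hball : ∀ n : ℕ, ∀ x : A, IsSelfAdjoint x → ‖x‖ ≤ 1 → ‖C x - x‖ ≤ 2 / 2 ^ n := by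
    intro n
    induction n with
    | zero =>
      intro x hx h
      refine (norm_sub_le _ _).trans ?_
      linarith [hC x hx]
    | succ n ih =>
      intro x hx hx1
      refine le_of_forall_pos_le_add fun ε' hε' => ?_
      obtain ⟨ε, hε, hε1, hεε'⟩ : ∃ ε : ℝ, 0 < ε ∧ ε < 1 ∧ 4 * ε ≤ ε' :=
        ⟨min (1 / 2) (ε' / 4), by positivity, (min_le_left _ _).trans_lt (by norm_num),
          by linarith [min_le_right (1 / 2) (ε' / 4)]⟩
      obtain ⟨g, hg, hgu, hgn⟩ := exists_isUnit_norm_sub_lt hrr0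
        ((IsSelfAdjoint.all (1 - ε)).smul hx) hε
      have h1 : ‖(1 - ε) • x‖ ≤ 1 - ε := by
        rw [norm_smul, Real.norm_of_nonneg (by linarith)]
        exact mul_le_of_le_one_right (by linarith) hx1
      have hg1 : ‖g‖ ≤ 1 := by
        have := norm_sub_norm_le g ((1 - ε) • x)
        rw [norm_sub_rev] at this
        linarith
      have hxg : ‖x - g‖ ≤ 2 * ε := by
        have e : x - g = ε • x + ((1 - ε) • x - g) := by module
        rw [e]
        refine (norm_add_le _ _).trans ?_
        have : ‖ε • x‖ ≤ ε := by
          rw [norm_smul, Real.norm_of_nonneg hε.le]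
          exact mul_le_of_le_one_right hε.le hx1
        linarith
      have hq := isStarProjection_posProj hg hgu
      set s := posProj g + posProj g - 1 with hs
      have hCs : C s = s := by
        rw [hs, map_sub, map_add, hp _ hq, hp 1 (.one A)]
      have hssa : IsSelfAdjoint s :=
        (hq.isSelfAdjoint.add hq.isSelfAdjoint).sub (IsSelfAdjoint.one A)
      have h2 := ih (g + g - s) ((hg.add hg).sub hssa) (norm_two_smul_sub_le hg hgu hg1)
      have e1 : C (g + g - s) - (g + g - s) = (2 : ℝ) • (C g - g) := by
        rw [map_sub, map_add, hCs]; module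
      rw [e1, norm_smul, Real.norm_two] at h2
      have e2 : C x - x = C (x - g) - (x - g) + (C g - g) := by
        rw [map_sub]; abel
      have h3 := hC _ (hx.sub hg)
      have h4 : ‖C x - x‖ ≤ ‖C (x - g)‖ + ‖x - g‖ + ‖C g - g‖ := by
        rw [e2]
        exact (norm_add_le _ _).trans (by gcongr; exact norm_sub_le _ _)
      have h5 : (2 : ℝ) / 2 ^ (n + 1) = 2 / 2 ^ n / 2 := by rw [pow_succ]; field_simp
      rw [h5]
      linarith
  have hball' : ∀ x : A, IsSelfAdjoint x → ‖x‖ ≤ 1 → C x = x := by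
    intro x hx h
    have hlim : Filter.Tendsto (fun n : ℕ => (2 : ℝ) / 2 ^ n) Filter.atTop (nhds 0) :=
      tendsto_const_nhds.div_atTop (tendsto_pow_atTop_atTop_of_one_lt one_lt_two)
    have := ge_of_tendsto' hlim fun n => hball n x hx h
    rw [← sub_eq_zero, ← norm_le_zero_iff]
    exact this
  obtain ⟨N, hN⟩ := exists_nat_gt ‖x‖
  have hN0 : (0 : ℝ) < N := (norm_nonneg x).trans_lt hN
  have h1 := hball' ((N : ℝ)⁻¹ • x) ((IsSelfAdjoint.all ((N : ℝ)⁻¹)).smul hx) (by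
    rw [norm_smul, norm_inv, Real.norm_of_nonneg hN0.le, inv_mul_le_iff₀ hN0]
    linarith)
  have h2 : x = N • ((N : ℝ)⁻¹ • x) := by
    rw [← Nat.cast_smul_eq_nsmul ℝ, smul_smul, mul_inv_cancel₀ hN0.ne', one_smul]
  rw [h2, map_nsmul, h1]

section ImaginaryDirection

variable {b C : A →+ A} (hb : ∀ k, IsSelfAdjoint (b k)) (hC : ∀ k, IsSelfAdjoint (C k))
  (hspec : ∀ x k : A, IsSelfAdjoint x → IsSelfAdjoint k →
    spectrum ℂ (x + b k + I • C k) ⊆ spectrum ℂ (x + I • k))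
  (hsing : ∀ k : A, IsSelfAdjoint k → ¬ IsUnit (1 - k) → ∀ r : ℝ,
    ¬ IsUnit (b k + r • (1 - k) + I • (C k - 1)))

include hb hC hspec

theorem algebraMap_le_map {t : ℝ} {k : A} (hk : algebraMap ℝ A t ≤ k) :
    algebraMap ℝ A t ≤ C k := by
  have hksa : IsSelfAdjoint k := .of_ge hk (IsSelfAdjoint.algebraMap A (IsSelfAdjoint.all t))
  rw [algebraMap_le_iff_le_spectrum (ha := hC k)]
  intro μ hμ
  by_contra! hlt
  rw [spectrum.mem_iff] at hμ
  have hmem : I * μ ∈ spectrum ℂ (-b k + b k + I • C k) := by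
    rw [spectrum.mem_iff]
    intro hu
    apply hμ
    have e : algebraMap ℂ A (I * μ) - (-b k + b k + I • C k) =
        Units.mk0 I I_ne_zero • (algebraMap ℝ A μ - C k) := by
      rw [Units.smul_def, Units.val_mk0]
      simp only [Algebra.algebraMap_eq_smul_one, ← Complex.coe_smul]
      module
    rw [e] at hu
    exact (isUnit_smul_iff _ _).1 hu
  have h2 := hspec _ k (hb k).neg hksa hmem
  rw [spectrum.mem_iff] at h2
  apply h2
  have hu := isUnit_add_I_smul (hb k).neg (sub_pos.2 hlt) (d := k - algebraMap ℝ A μ) (by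
    rw [map_sub]; gcongr)
  have e : algebraMap ℂ A (I * μ) - (-b k + I • k) =
      -(-b k + I • (k - algebraMap ℝ A μ)) := by
    simp only [Algebra.algebraMap_eq_smul_one, ← Complex.coe_smul]
    module
  rw [e]
  exact hu.neg

theorem map_nonneg_of_nonneg {k : A} (hk : 0 ≤ k) : 0 ≤ C k := by
  simpa using algebraMap_le_map hb hC hspec (t := 0) (by simpa using hk)

theorem map_one_eq_one : C 1 = 1 := by
  refine le_antisymm ?_ ?_
  · have := algebraMap_le_map hb hC hspec (t := -1) (k := -1) (by simp)
    simpa using this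
  · have := algebraMap_le_map hb hC hspec (t := 1) (k := 1) (by simp)
    simpa using this

theorem norm_map_le {k : A} (hk : IsSelfAdjoint k) : ‖C k‖ ≤ ‖k‖ := by
  have h1 := algebraMap_le_map hb hC hspec (t := -‖k‖) (k := k) (by
    simpa using hk.neg_algebraMap_norm_le_self)
  have h2 := algebraMap_le_map hb hC hspec (t := -‖k‖) (k := -k) (by
    simpa using hk.le_algebraMap_norm_self)
  rw [map_neg, map_neg, neg_le_neg_iff] at h2
  rw [← cfc_id ℝ (C k)]
  refine norm_cfc_le (norm_nonneg _) fun t ht => ?_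
  rw [algebraMap_le_iff_le_spectrum (ha := hC k)] at h1
  rw [le_algebraMap_iff_spectrum_le (ha := hC k)] at h2
  exact abs_le.2 ⟨h1 t ht, h2 t ht⟩

include hsing

theorem exists_norm_conj_one_sub_map_le {k : A} (hk0 : 0 ≤ k) (hk1 : k ≤ 1)
    (hu : ¬ IsUnit (1 - k)) {ε : ℝ} (hε : 0 < ε) :
    ∃ e : A, ‖e‖ = 1 ∧ ‖star e * (1 - C k) * e‖ ≤ ε ∧ ‖(1 - k) * e‖ ≤ ε := by
  have hksa : IsSelfAdjoint k := .of_nonneg hk0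
  set r : ℝ := (2 + ‖b k‖) / ε with hr
  have hr0 : 0 < r := by positivity
  have h1 := hsing k hksa hu r
  have hC0 := map_nonneg_of_nonneg hb hC hspec hk0
  have hC1 : ‖C k - 1‖ ≤ 1 := by
    have h2 := map_nonneg_of_nonneg hb hC hspec (sub_nonneg.2 hk1)
    rw [map_sub, map_one_eq_one hb hC hspec] at h2
    rw [norm_sub_rev, CStarAlgebra.norm_le_one_iff_of_nonneg _ h2]
    simpa using hC0
  obtain ⟨e, he, h3, h4⟩ := exists_of_not_isUnit_add_I_smul
    ((hb k).add ((IsSelfAdjoint.all r).smul ((IsSelfAdjoint.one A).sub hksa)))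
    ((hC k).sub (IsSelfAdjoint.one A)) h1 (lt_min hε one_pos)
  refine ⟨e, he, ?_, ?_⟩
  · have e1 : star e * (1 - C k) * e = -(star e * (C k - 1) * e) := by noncomm_ring
    rw [e1, norm_neg]
    exact h3.trans (min_le_left _ _)
  · have h5 : ‖(C k - 1) * e‖ ≤ 1 := by
      refine (norm_mul_le _ _).trans ?_
      rwa [he, mul_one]
    have h6 : ‖b k * e‖ ≤ ‖b k‖ := by
      refine (norm_mul_le _ _).trans ?_
      rw [he, mul_one]
    have h7 : r • ((1 - k) * e) = (b k + r • (1 - k)) * e - b k * e := by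
      rw [add_mul, smul_mul_assoc]; abel
    have h8 : r * ‖(1 - k) * e‖ ≤ 2 + ‖b k‖ := by
      calc r * ‖(1 - k) * e‖ = ‖r • ((1 - k) * e)‖ := by
            rw [norm_smul, Real.norm_of_nonneg hr0.le]
        _ ≤ ‖(b k + r • (1 - k)) * e‖ + ‖b k * e‖ := by rw [h7]; exact norm_sub_le _ _
        _ ≤ _ := by linarith [min_le_right ε 1]
    have h9 : 2 + ‖b k‖ = r * ε := by rw [hr]; field_simp
    rw [h9] at h8
    exact le_of_mul_le_mul_left h8 hr0

theorem le_map_of_isStarProjection {p : A} (hp : IsStarProjection p) : p ≤ C p := by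
  have hp0 := hp.nonneg
  have hp1 := hp.le_one
  have hpp : p * p = p := hp.isIdempotentElem
  have hps : star p = p := hp.isSelfAdjoint
  set c := C p with hc
  have hc0 : 0 ≤ c := map_nonneg_of_nonneg hb hC hspec hp0
  have hc1 : c ≤ 1 := by
    have := map_nonneg_of_nonneg hb hC hspec (sub_nonneg.2 hp1)
    rwa [map_sub, map_one_eq_one hb hC hspec, sub_nonneg] at this
  have hd0 : 0 ≤ 1 - c := sub_nonneg.2 hc1
  have hd1 : 1 - c ≤ 1 := by simpa using hc0
  set y := p * (1 - c) * p with hy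
  have hy0 : 0 ≤ y := by
    have := star_left_conjugate_nonneg hd0 p
    rwa [hps] at this
  have hy' : ∀ e : A, ‖y * e‖ ≤ ‖(1 - c) * (p * e)‖ * ‖p‖ := by
    intro e
    rw [hy, mul_assoc, mul_assoc, mul_comm (‖_‖)]
    exact norm_mul_le _ _
  by_cases hyz : y = 0
  · have h1 : ‖(1 - c) * p‖ ^ 2 ≤ 0 := by
      have := norm_mul_sq_le_norm_conj hd0 hd1 p
      rwa [hps, ← hy, hyz, norm_zero] at this
    have h2 : (1 - c) * p = 0 := by
      rw [← norm_le_zero_iff]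
      nlinarith [norm_nonneg ((1 - c) * p)]
    have h3 : c * p = p := by
      rw [sub_mul, one_mul, sub_eq_zero] at h2
      exact h2.symm
    have h4 : p * c = p := by
      have := congrArg star h3
      rwa [star_mul, hps, (hC p).star_eq] at this
    have h5 := star_left_conjugate_nonneg hc0 (1 - p)
    have h6 : star (1 - p) * c * (1 - p) = c - p := by
      rw [star_sub, star_one, hps, sub_mul, one_mul, h4, mul_sub, mul_one, sub_mul, hpp, h3]
      abel
    rwa [h6, sub_nonneg] at h5
  exfalso
  have hm : 0 < ‖y‖ := norm_pos_iff.2 hyz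
  set m := ‖y‖ with hmdef
  set k := m⁻¹ • y with hk
  have hk0 : 0 ≤ k := smul_nonneg (by positivity) hy0
  have hk1 : k ≤ 1 := by
    rw [← CStarAlgebra.norm_le_one_iff_of_nonneg _ hk0, hk, norm_smul, norm_inv,
      Real.norm_of_nonneg hm.le, ← hmdef, inv_mul_cancel₀ hm.ne']
  have hkp : k ≤ p := by
    have h1 := star_left_conjugate_le_conjugate hk1 p
    rw [hps, mul_one, hpp] at h1
    have h2 : p * k * p = k := by
      rw [hk, mul_smul_comm, smul_mul_assoc, hy]
      congr 1
      rw [show p * (p * (1 - c) * p) * p = (p * p) * (1 - c) * (p * p) by noncomm_ring, hpp]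
    rwa [h2] at h1
  have hnt : Nontrivial A := ⟨y, 0, hyz⟩
  have hku : ¬ IsUnit (1 - k) := by
    intro hu
    have h1 : m ∈ spectrum ℝ y := CStarAlgebra.norm_mem_spectrum_of_nonneg hy0
    rw [spectrum.mem_iff] at h1
    apply h1
    have e : algebraMap ℝ A m - y = Units.mk0 m hm.ne' • (1 - k) := by
      rw [Units.smul_def, Units.val_mk0, smul_sub, hk, smul_smul, mul_inv_cancel₀ hm.ne',
        one_smul, Algebra.algebraMap_eq_smul_one]
    rw [e]
    exact hu.smul _
  obtain ⟨δ, hδ, hδ1, hδm⟩ : ∃ δ : ℝ, 0 < δ ∧ δ ≤ 1 / 2 ∧ δ ≤ m / 8 :=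
    ⟨min (1 / 2) (m / 8), by positivity, min_le_left _ _, min_le_right _ _⟩
  obtain ⟨e, he, h1, h2⟩ := exists_norm_conj_one_sub_map_le hb hC hspec hsing hk0 hk1 hku
    (pow_pos hδ 2)
  have hconj : ∀ {d d' : A}, 0 ≤ d → d ≤ 1 → d ≤ d' → ‖star e * d' * e‖ ≤ δ ^ 2 →
      ‖d * e‖ ≤ δ := by
    intro d d' hd hd1 hdd' h
    refine le_of_sq_le_sq ((norm_mul_sq_le_norm_conj hd hd1 e).trans (le_trans ?_ h)) hδ.le
    exact CStarAlgebra.norm_le_norm_of_nonneg_of_le (star_left_conjugate_nonneg hd e)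
      (star_left_conjugate_le_conjugate hdd' e)
  have hp' : ‖(1 - p) * e‖ ≤ δ := by
    refine hconj (sub_nonneg.2 hp1) (by simpa using hp0) (sub_le_sub_left hkp 1) ?_
    rw [mul_assoc]
    refine (norm_mul_le _ _).trans ?_
    rwa [norm_star, he, one_mul]
  have hc' : ‖(1 - c) * e‖ ≤ δ := by
    refine hconj hd0 hd1 (sub_le_sub_left ?_ 1) h1
    have := map_nonneg_of_nonneg hb hC hspec (sub_nonneg.2 hkp)
    rwa [map_sub, sub_nonneg] at this
  have hpn : ‖p‖ ≤ 1 := (CStarAlgebra.norm_le_one_iff_of_nonneg _ hp0).2 hp1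
  have hdn : ‖1 - c‖ ≤ 1 := (CStarAlgebra.norm_le_one_iff_of_nonneg _ hd0).2 hd1
  have h3 : ‖(1 - c) * (p * e)‖ ≤ 2 * δ := by
    have e1 : (1 - c) * (p * e) = (1 - c) * e - (1 - c) * ((1 - p) * e) := by noncomm_ring
    rw [e1]
    refine (norm_sub_le _ _).trans ?_
    have : ‖(1 - c) * ((1 - p) * e)‖ ≤ 1 * δ := (norm_mul_le _ _).trans (by gcongr)
    linarith
  have h4 : ‖y * e‖ ≤ 2 * δ := by
    refine (hy' e).trans ?_
    calc _ ≤ 2 * δ * 1 := by gcongr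
      _ = 2 * δ := mul_one _
  have h5 : 1 - δ ^ 2 ≤ ‖k * e‖ := by
    have e1 : e = k * e + (1 - k) * e := by noncomm_ring
    have := norm_add_le (k * e) ((1 - k) * e)
    rw [← e1, he] at this
    linarith
  have h6 : ‖k * e‖ = m⁻¹ * ‖y * e‖ := by
    rw [hk, smul_mul_assoc, norm_smul, norm_inv, Real.norm_of_nonneg hm.le]
  rw [h6] at h5
  have h7 : m * (1 - δ ^ 2) ≤ 2 * δ := by
    calc m * (1 - δ ^ 2) ≤ m * (m⁻¹ * ‖y * e‖) := by gcongr
      _ = ‖y * e‖ := mul_inv_cancel_left₀ hm.ne' _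
      _ ≤ _ := h4
  nlinarith [mul_pos hm hδ]

theorem map_isStarProjection {p : A} (hp : IsStarProjection p) : C p = p := by
  refine le_antisymm ?_ (le_map_of_isStarProjection hb hC hspec hsing hp)
  have := le_map_of_isStarProjection hb hC hspec hsing hp.one_sub
  rwa [map_sub, map_one_eq_one hb hC hspec, sub_le_sub_iff_left] at this

end ImaginaryDirection

theorem map_eq_zero_of_spectrum_subset
    (hrr0 : ∀ a : A, IsSelfAdjoint a → a ∈ closure {x : A | IsSelfAdjoint x ∧ IsUnit x})
    {b : A →+ A} (hb : ∀ k, IsSelfAdjoint (b k))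
    (hspec : ∀ x k : A, IsSelfAdjoint x → IsSelfAdjoint k →
      spectrum ℂ (x + b k + I • k) ⊆ spectrum ℂ (x + I • k))
    {k : A} (hk : IsSelfAdjoint k) : b k = 0 := by
  have hiter : ∀ (j : ℕ) (x k : A), IsSelfAdjoint x → IsSelfAdjoint k →
      spectrum ℂ (x + j • b k + I • k) ⊆ spectrum ℂ (x + I • k) := by
    intro j x k hx hk
    induction j with
    | zero => simp
    | succ j ih =>
      refine Set.Subset.trans ?_ ih
      have := hspec (x + j • b k) k (hx.add ((IsSelfAdjoint.all j).smul (hb k))) hk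
      rwa [add_assoc x, ← succ_nsmul] at this
  have hnonneg : ∀ k : A, IsSelfAdjoint k → -b k ≤ 0 := by
    intro k hk
    refine nonpos_of_spectrum_add_I_smul_subset hrr0 (hb k).neg hk fun m hm x hx => ?_
    have hm0 : (m : ℝ) ≠ 0 := by exact_mod_cast hm.ne'
    have hmk : m • b ((m : ℝ)⁻¹ • k) = b k := by
      rw [← map_nsmul, ← Nat.cast_smul_eq_nsmul ℝ, smul_smul, mul_inv_cancel₀ hm0, one_smul]
    have := hiter m (x + -b k) ((m : ℝ)⁻¹ • k) (hx.add (hb k).neg)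
      ((IsSelfAdjoint.all ((m : ℝ)⁻¹)).smul hk)
    rwa [hmk, neg_add_cancel_right] at this
  refine le_antisymm ?_ ?_
  · have := hnonneg (-k) hk.neg
    rwa [map_neg, neg_neg] at this
  · exact neg_nonpos.1 (hnonneg k hk)

/-- An additive map on a C⋆-algebra of real rank zero which fixes the self-adjoint elements and
shrinks spectra is the identity, as soon as it preserves a certain singular point. -/
theorem eq_self_of_spectrum_subset
    (hrr0 : ∀ a : A, IsSelfAdjoint a → a ∈ closure {x : A | IsSelfAdjoint x ∧ IsUnit x})
    (R : A →+ A) (hRsa : ∀ h, IsSelfAdjoint h → R h = h)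
    (hRs : ∀ x, spectrum ℂ (R x) ⊆ spectrum ℂ x)
    (hsing : ∀ k : A, IsSelfAdjoint k → ¬ IsUnit (1 - k) → ∀ r : ℝ,
      ¬ IsUnit (R (I • k + r • (1 - k)) - I • 1)) (x : A) : R x = x := by
  set b : A →+ A := AddMonoidHom.mk' (fun y => (ℜ (R (I • y)) : A)) (by simp) with hbdef
  set C : A →+ A := AddMonoidHom.mk' (fun y => (ℑ (R (I • y)) : A)) (by simp) with hCdef
  have hR : ∀ y, R (I • y) = b y + I • C y := fun y =>
    (realPart_add_I_smul_imaginaryPart (R (I • y))).symm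
  have hb : ∀ y, IsSelfAdjoint (b y) := fun y => (ℜ (R (I • y))).2
  have hC : ∀ y, IsSelfAdjoint (C y) := fun y => (ℑ (R (I • y))).2
  have hspec : ∀ x k : A, IsSelfAdjoint x → IsSelfAdjoint k →
      spectrum ℂ (x + b k + I • C k) ⊆ spectrum ℂ (x + I • k) := by
    intro x k hx _
    have := hRs (x + I • k)
    rwa [map_add, hRsa x hx, hR, ← add_assoc] at this
  have hsing' : ∀ k : A, IsSelfAdjoint k → ¬ IsUnit (1 - k) → ∀ r : ℝ,
      ¬ IsUnit (b k + r • (1 - k) + I • (C k - 1)) := by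
    intro k hk hu r
    have h1 := hsing k hk hu r
    rw [map_add, hR, hRsa _ ((IsSelfAdjoint.all r).smul ((IsSelfAdjoint.one A).sub hk))] at h1
    convert h1 using 2
    module
  have hCid : ∀ k, IsSelfAdjoint k → C k = k := fun k hk =>
    eq_self_of_forall_isStarProjection hrr0 C (fun _ => norm_map_le hb hC hspec)
      (fun _ => map_isStarProjection hb hC hspec hsing') hk
  have hb0 : ∀ k, IsSelfAdjoint k → b k = 0 := fun k hk =>
    map_eq_zero_of_spectrum_subset hrr0 hb (fun x k hx hk => by
      simpa only [hCid k hk] using hspec x k hx hk) hk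
  rw [← realPart_add_I_smul_imaginaryPart x, map_add, hRsa _ (ℜ x).2, hR, hb0 _ (ℑ x).2,
    hCid _ (ℑ x).2, zero_add]

omit [PartialOrder A] [StarOrderedRing A] in
theorem eq_zero_of_spectrum_add_eq {a : A} (h : ∀ z : A, spectrum ℂ (z + a) = spectrum ℂ z) :
    a = 0 := by
  rcases subsingleton_or_nontrivial A with _ | _
  · exact Subsingleton.elim _ _
  have ha : spectrum ℂ a ⊆ {0} := by
    have := h 0
    rw [zero_add, spectrum.zero_eq] at this
    exact this.le
  have hs : spectrum ℂ (star a) ⊆ {0} := by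
    rw [spectrum.map_star]
    intro z hz
    simpa using ha hz
  have h1 : star a + a = 0 := by
    have : IsStarNormal (star a + a) := (IsSelfAdjoint.star_add_self a).isStarNormal
    exact CFC.eq_zero_of_spectrum_subset_zero (R := ℂ) _ (by rw [h]; exact hs)
  have h2 : -star a + a = 0 := by
    have : IsStarNormal (-star a + a) := ⟨by
      have e : star (-star a + a) = -(-star a + a) := by simp [add_comm]
      rw [e]
      exact (Commute.refl _).neg_left⟩
    refine CFC.eq_zero_of_spectrum_subset_zero (R := ℂ) _ ?_
    rw [h, ← spectrum.neg_eq]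
    intro z hz
    simpa using hs hz
  have h3 : (2 : ℂ) • a = 0 := by
    have : (2 : ℂ) • a = (star a + a) + (-star a + a) := by module
    rw [this, h1, h2, add_zero]
  exact (smul_eq_zero.1 h3).resolve_left two_ne_zero

/-- A spectrum-preserving additive surjection and a unital Jordan homomorphism which agree on the
self-adjoint elements of a C⋆-algebra of real rank zero agree everywhere: here `R` plays the role
of `T⁻¹ ∘ S`. -/
theorem eq_self_of_jordan
    (hrr0 : ∀ a : A, IsSelfAdjoint a → a ∈ closure {x : A | IsSelfAdjoint x ∧ IsUnit x})
    {B : Type*} [Ring B] [Algebra ℂ B] (T : A → B)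
    (hadd : ∀ x y : A, T (x + y) = T x + T y)
    (hspec : ∀ x : A, spectrum ℂ (T x) = spectrum ℂ x)
    (S : A →ₗ[ℂ] B) (hS1 : S 1 = 1) (hSj : ∀ x : A, S (x * x) = S x * S x)
    (hST : ∀ a : A, IsSelfAdjoint a → S a = T a)
    (R : A → A) (hR : ∀ x : A, T (R x) = S x) (x : A) : R x = x := by
  set T' : A →+ B := AddMonoidHom.mk' T hadd with hT'
  have hinj : Function.Injective T := by
    refine (injective_iff_map_eq_zero T').2 fun a ha => eq_zero_of_spectrum_add_eq fun z => ?_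
    have ha' : T a = 0 := ha
    rw [← hspec, hadd, ha', add_zero, hspec]
  have hRadd : ∀ x y, R (x + y) = R x + R y := fun x y => hinj (by
    rw [hadd, hR, hR, hR, map_add])
  have hRsa : ∀ h, IsSelfAdjoint h → R h = h := fun h hh => hinj (by rw [hR, hST h hh])
  have hmap : ∀ c : ℂ, S (algebraMap ℂ A c) = algebraMap ℂ B c := fun c => by
    rw [Algebra.algebraMap_eq_smul_one, map_smul, hS1, Algebra.algebraMap_eq_smul_one]
  have hRspec : ∀ x, spectrum ℂ (R x) = spectrum ℂ (S x) := fun x => by rw [← hspec, hR]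
  refine eq_self_of_spectrum_subset hrr0 (AddMonoidHom.mk' R hRadd) hRsa (fun x z hz => ?_)
    (fun k hk hu r hunit => ?_) x
  · have hz' : z ∈ spectrum ℂ (S x) := by rw [← hRspec]; exact hz
    rw [spectrum.mem_iff] at hz' ⊢
    intro h
    apply hz'
    rw [← hmap, ← map_sub]
    exact isUnit_map_of_jordan S hS1 hSj h
  · have hsa : IsSelfAdjoint (1 - k) := (IsSelfAdjoint.one A).sub hk
    have h0 : ¬ IsUnit (S (1 - k)) := by
      rw [← spectrum.zero_mem_iff ℂ, hST _ hsa, hspec, spectrum.zero_mem_iff ℂ]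
      exact hu
    have hmem : I ∈ spectrum ℂ (R (I • k + r • (1 - k))) := by
      rw [hRspec, spectrum.mem_iff]
      intro h
      have hrI : I - (r : ℂ) ≠ 0 := fun h' => by simpa using congrArg im h'
      have e : algebraMap ℂ B I - S (I • k + r • (1 - k)) =
          Units.mk0 (I - (r : ℂ)) hrI • S (1 - k) := by
        rw [← hmap, ← map_sub, Units.smul_def, Units.val_mk0, ← map_smul,
          Algebra.algebraMap_eq_smul_one, ← Complex.coe_smul]
        congr 1
        module
      rw [e] at h
      exact h0 ((isUnit_smul_iff _ _).1 h)
    rw [spectrum.mem_iff, IsUnit.sub_iff, Algebra.algebraMap_eq_smul_one] at hmem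
    exact hmem hunit

end CStarAlgebra

/-- With `T`, `S`, `R` as in the paper (`R = T⁻¹ ∘ S`), setting
`R̃x = ½(Rx − i·R(ix))` and `Wx = ½(R(x*) + i·R(i·x*))`, one has `R̃x + Wx = x` for all
`x`, and for every `α ∈ ℂ` the map `R̃ + αW` is a Jordan homomorphism. -/
theorem tildeR_plus_alphaW_jordan
    {A : Type*} [NormedRing A] [StarRing A] [CStarRing A] [NormedAlgebra ℂ A]
    [CompleteSpace A] [StarModule ℂ A]
    (hrr0 : ∀ a : A, IsSelfAdjoint a → a ∈ closure {x : A | IsSelfAdjoint x ∧ IsUnit x})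
    {B : Type*} [NormedRing B] [NormedAlgebra ℂ B] [CompleteSpace B]
    (T : A → B)
    (hsurj : Function.Surjective T)
    (hadd : ∀ x y : A, T (x + y) = T x + T y)
    (hspec : ∀ x : A, spectrum ℂ (T x) = spectrum ℂ x)
    (S : A →ₗ[ℂ] B) (hS1 : S 1 = 1) (hSj : ∀ x : A, S (x * x) = S x * S x)
    (hST : ∀ a : A, IsSelfAdjoint a → S a = T a)
    (R : A → A) (hR : ∀ x : A, T (R x) = S x)
    (Rt W : A → A)
    (hRt : ∀ x : A, Rt x = ((1 : ℂ) / 2) • (R x - Complex.I • R (Complex.I • x)))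
    (hW : ∀ x : A,
      W x = ((1 : ℂ) / 2) • (R (star x) + Complex.I • R (Complex.I • star x))) :
    (∀ x : A, Rt x + W x = x) ∧
      ∀ (α : ℂ) (x : A),
        Rt (x * x) + α • W (x * x) = (Rt x + α • W x) * (Rt x + α • W x) := by
  let : CStarAlgebra A := { }
  let := CStarAlgebra.spectralOrder A
  have := CStarAlgebra.spectralOrderedRing A
  have hRid : ∀ x, R x = x := eq_self_of_jordan hrr0 T hadd hspec S hS1 hSj hST R hR
  have hRt' : ∀ x, Rt x = x := fun x => by
    rw [hRt, hRid, hRid, smul_smul, Complex.I_mul_I]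
    module
  have hW' : ∀ x, W x = 0 := fun x => by
    rw [hW, hRid, hRid, smul_smul, Complex.I_mul_I]
    module
  simp [hRt', hW']
end

section
/- Let A be a unital C*-algebra of real rank zero, let B be a complex unital Banach algebra, and let T : A → B be a surjective additive map with σ(Tx) = σ(x) for all x ∈ A. If e ∈ A is a central projection (e = e* = e² and e lies in the centre of A), then T(ex) = Te · Tx for all x ∈ A. -/
/-- In a complete normed algebra, a given element becomes invertible after adding any large
enough natural number. -/
theorem exists_forall_ge_isUnit_add_natCast {B : Type*} [NormedRing B] [NormedAlgebra ℂ B]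
    [CompleteSpace B] (a : B) : ∃ K : ℕ, ∀ k : ℕ, K ≤ k → IsUnit (a + k) := by
  obtain ⟨K, hK⟩ := exists_nat_gt (‖-a‖ * ‖(1 : B)‖)
  refine ⟨K, fun k hk => ?_⟩
  have h : ‖-a‖ * ‖(1 : B)‖ < ‖(k : ℂ)‖ := by
    rw [Complex.norm_natCast]
    exact hK.trans_le (by exact_mod_cast hk)
  have := spectrum.mem_resolventSet_of_norm_lt_mul h
  rw [spectrum.mem_resolventSet_iff] at this
  simpa [add_comm] using this

/-- `1 - a` is invertible as soon as some power of `a` has norm less than one. -/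
theorem isUnit_one_sub_of_norm_pow_lt_one {B : Type*} [NormedRing B]
    [CompleteSpace B] {a : B} {n : ℕ} (h : ‖a ^ n‖ < 1) : IsUnit (1 - a) := by
  have hu : IsUnit (1 - a ^ n) := isUnit_one_sub_of_norm_lt_one h
  have h1 : (1 - a) * ∑ i ∈ Finset.range n, a ^ i = 1 - a ^ n := mul_neg_geom_sum a n
  have hc : Commute (1 - a) (∑ i ∈ Finset.range n, a ^ i) := by
    rw [Commute, SemiconjBy, h1, geom_sum_mul_neg]
  exact (hc.isUnit_mul_iff.1 (h1 ▸ hu)).1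

/-- An element with spectrum contained in `{0}` has spectral radius zero. -/
theorem spectralRadius_eq_zero_of_subset_singleton {B : Type*} [NormedRing B] [NormedAlgebra ℂ B]
    {c : B} (hs : spectrum ℂ c ⊆ {0}) : spectralRadius ℂ c = 0 := by
  rw [spectralRadius, ← nonpos_iff_eq_zero]
  refine iSup₂_le fun s hmem => ?_
  rw [hs hmem]
  simp

/-- Gluing two units along a central idempotent gives a unit. -/
theorem IsIdempotentElem.isUnit_mul_add_one_sub_mul {R : Type*} [Ring R] {e a b : R}
    (he : IsIdempotentElem e) (hc : ∀ x, e * x = x * e) (ha : IsUnit a) (hb : IsUnit b) :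
    IsUnit (e * a + (1 - e) * b) := by
  obtain ⟨a, rfl⟩ := ha
  obtain ⟨b, rfl⟩ := hb
  have hf : IsIdempotentElem (1 - e) := he.one_sub
  have hfc : ∀ x, (1 - e) * x = x * (1 - e) := fun x => by rw [sub_mul, mul_sub, hc]; simp
  have key : ∀ u v : R, ∀ u' v' : R, u * u' = 1 → v * v' = 1 →
      (e * u + (1 - e) * v) * (e * u' + (1 - e) * v') = 1 := by
    intro u v u' v' h h'
    have e1 : e * u * (e * u') = e := by
      rw [mul_assoc, ← mul_assoc u, ← hc u, mul_assoc e u, h, mul_one, he.eq]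
    have e2 : (1 - e) * v * ((1 - e) * v') = 1 - e := by
      rw [mul_assoc, ← mul_assoc v, ← hfc v, mul_assoc (1 - e) v, h', mul_one, hf.eq]
    have e3 : e * u * ((1 - e) * v') = 0 := by
      rw [mul_assoc, ← mul_assoc u, ← hfc u, mul_assoc (1 - e), ← mul_assoc e,
        he.mul_one_sub_self, zero_mul]
    have e4 : (1 - e) * v * (e * u') = 0 := by
      rw [mul_assoc, ← mul_assoc v, ← hc v, mul_assoc e, ← mul_assoc (1 - e),
        he.one_sub_mul_self, zero_mul]
    rw [add_mul, mul_add, mul_add, e1, e2, e3, e4]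
    abel
  exact ⟨⟨_, _, key a b (↑a⁻¹) (↑b⁻¹) (by simp) (by simp),
    key (↑a⁻¹) (↑b⁻¹) a b (by simp) (by simp)⟩, rfl⟩

/-- `x` belongs to the perturbation class of the group of units: adding `x` to a unit gives
a unit. -/
def IsUnitPerturbation {R : Type*} [Ring R] (x : R) : Prop :=
  ∀ a : R, IsUnit a → IsUnit (x + a)

namespace IsUnitPerturbation

theorem add {R : Type*} [Ring R] {x y : R} (hx : IsUnitPerturbation x)
    (hy : IsUnitPerturbation y) : IsUnitPerturbation (x + y) := fun a ha => by
  rw [add_assoc]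
  exact hx _ (hy a ha)

theorem isUnit_mul {R : Type*} [Ring R] {x b : R} (hx : IsUnitPerturbation x)
    (hb : IsUnit b) : IsUnitPerturbation (b * x) := fun a ha => by
  obtain ⟨b, rfl⟩ := hb
  have h := b.isUnit.mul (hx (↑b⁻¹ * a) (b⁻¹.isUnit.mul ha))
  rwa [mul_add, Units.mul_inv_cancel_left] at h

theorem mul_left {B : Type*} [NormedRing B] [NormedAlgebra ℂ B] [CompleteSpace B] {x : B}
    (hx : IsUnitPerturbation x) (b : B) : IsUnitPerturbation (b * x) := by
  obtain ⟨K, hK⟩ := exists_forall_ge_isUnit_add_natCast b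
  obtain ⟨L, hL⟩ := exists_forall_ge_isUnit_add_natCast (0 : B)
  have hu : IsUnit (-((max K L : ℕ) : B)) := by
    simpa using hL _ (le_max_right K L)
  have h := (hx.isUnit_mul (hK _ (le_max_left K L))).add (hx.isUnit_mul hu)
  rwa [← add_mul, add_neg_cancel_right] at h

/-- A C⋆-algebra has no nonzero unit perturbations. -/
theorem eq_zero {A : Type*} [NormedRing A] [StarRing A] [CStarRing A] [NormedAlgebra ℂ A]
    [CompleteSpace A] [StarModule ℂ A] {x : A} (hx : IsUnitPerturbation x) : x = 0 := by
  have hs : spectrum ℂ (star x * x) ⊆ {0} := by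
    intro s hmem
    by_contra hne
    have hs0 : s ≠ 0 := hne
    apply hmem
    have hu : IsUnit (-algebraMap ℂ A s) :=
      ((isUnit_iff_ne_zero.2 hs0).map (algebraMap ℂ A)).neg
    have := (hx.mul_left (star x) _ hu).neg
    rw [neg_add, neg_neg, neg_add_eq_sub] at this
    exact this
  have hr := spectralRadius_eq_zero_of_subset_singleton hs
  let : CStarAlgebra A := { }
  rw [(IsSelfAdjoint.star_mul_self x).spectralRadius_eq_nnnorm] at hr
  simpa using hr

end IsUnitPerturbation

/-- If `z + p` is a unit whenever `z` and `z + 1` are, then every commutator with `p` is a unit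
perturbation. -/
theorem isUnitPerturbation_commutator {B : Type*} [NormedRing B] [NormedAlgebra ℂ B]
    [CompleteSpace B] {p : B} (hp : ∀ z : B, IsUnit z → IsUnit (z + 1) → IsUnit (z + p))
    (x : B) : IsUnitPerturbation (p * x - x * p) := by
  intro y hy
  have hp' : ∀ z : B, IsUnit z → IsUnit (z - 1) → IsUnit (z - p) := by
    intro z hz hz1
    have := hp (-z) hz.neg (by simpa [neg_add_eq_sub] using hz1.neg)
    simpa [neg_add_eq_sub] using this.neg
  obtain ⟨K, hK⟩ := exists_forall_ge_isUnit_add_natCast x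
  obtain ⟨L, hL⟩ := exists_forall_ge_isUnit_add_natCast (x + y)
  obtain ⟨M, hM⟩ := exists_forall_ge_isUnit_add_natCast (x - y)
  set k := max K (max L M)
  obtain ⟨g, hg⟩ := hK k (by simp [k])
  have h1 := hL k (by simp [k])
  have h2 := hM k (by simp [k])
  have hx : x = g - k := by rw [hg]; simp
  have hv : IsUnit (y * ↑g⁻¹) := hy.mul g⁻¹.isUnit
  have hv1 : IsUnit (y * ↑g⁻¹ + 1) := by
    have : y * ↑g⁻¹ + 1 = (x + y + k) * ↑g⁻¹ := by
      rw [hx, ← g.mul_inv, ← add_mul]; congr 1; abel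
    rw [this]
    exact h1.mul g⁻¹.isUnit
  have hv2 : IsUnit (y * ↑g⁻¹ - 1) := by
    have : y * ↑g⁻¹ - 1 = -((x - y + k) * ↑g⁻¹) := by
      rw [hx, ← g.mul_inv, ← sub_mul, ← neg_mul]; congr 1; abel
    rw [this]
    exact (h2.mul g⁻¹.isUnit).neg
  have hconj : ∀ w : B, IsUnit (↑g⁻¹ * w * g) ↔ IsUnit w := fun w => by
    rw [Units.isUnit_mul_units, Units.isUnit_units_mul]
  have hsub : ∀ w : B, IsUnit w → IsUnit (w - 1) → IsUnit (w - g * p * ↑g⁻¹) := by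
    intro w hw hw1
    have := hp' (↑g⁻¹ * w * g) ((hconj w).2 hw) (by
      have : (↑g⁻¹ * w * g - 1 : B) = ↑g⁻¹ * (w - 1) * g := by
        simp [mul_sub, sub_mul]
      rw [this]
      exact (hconj _).2 hw1)
    rw [← hconj]
    have e : (↑g⁻¹ * (w - g * p * ↑g⁻¹) * g : B) = ↑g⁻¹ * w * g - p := by
      simp [mul_sub, sub_mul, mul_assoc]
    rwa [e]
  have h3 : IsUnit (y * ↑g⁻¹ - g * p * ↑g⁻¹ + p) := by
    refine hp _ (hsub _ hv hv2) ?_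
    rw [sub_add_eq_add_sub]
    exact hsub _ hv1 (by simpa using hv)
  rw [← Units.isUnit_mul_units _ g] at h3
  have e : (y * ↑g⁻¹ - g * p * ↑g⁻¹ + p) * g = p * x - x * p + y := by
    rw [hx]
    simp only [sub_mul, add_mul, mul_sub, mul_assoc, Units.inv_mul, mul_one,
      (Nat.cast_commute k p).eq]
    abel
  rwa [e] at h3

/-- A central quasinilpotent element is a unit perturbation. -/
theorem isUnitPerturbation_of_central_of_spectrum_subset {B : Type*} [NormedRing B]
    [NormedAlgebra ℂ B] [CompleteSpace B] {c : B} (hc : ∀ x, Commute c x)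
    (hs : spectrum ℂ c ⊆ {0}) : IsUnitPerturbation c := by
  rintro _ ⟨y, rfl⟩
  have hlim := spectrum.pow_norm_pow_one_div_tendsto_nhds_spectralRadius c
  rw [spectralRadius_eq_zero_of_subset_singleton hs] at hlim
  set w : B := ↑y⁻¹
  have hpos : (0 : ENNReal) < ENNReal.ofReal (1 / (‖w‖ + 1)) := by
    rw [ENNReal.ofReal_pos]; positivity
  obtain ⟨n, hn, hn0⟩ := ((hlim.eventually_lt_const hpos).and
    (Filter.eventually_gt_atTop 0)).exists
  have hn1 : ‖c ^ n‖ ^ (1 / n : ℝ) < 1 / (‖w‖ + 1) :=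
    (ENNReal.ofReal_lt_ofReal_iff (by positivity)).1 hn
  have hn2 : ‖c ^ n‖ < (1 / (‖w‖ + 1)) ^ n := by
    have := pow_lt_pow_left₀ hn1 (by positivity) hn0.ne'
    rwa [one_div, Real.rpow_inv_natCast_pow (norm_nonneg _) hn0.ne'] at this
  have hlt : ‖(-(c * w)) ^ n‖ < 1 := by
    have h1 : ‖(-(c * w)) ^ n‖ = ‖c ^ n * w ^ n‖ := by
      rw [← (hc w).mul_pow]
      rcases n.even_or_odd with h | h <;> simp [h.neg_pow]
    rw [h1]
    calc ‖c ^ n * w ^ n‖ ≤ ‖c ^ n‖ * ‖w ^ n‖ := norm_mul_le _ _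
      _ ≤ ‖c ^ n‖ * ‖w‖ ^ n := by gcongr; exact norm_pow_le' _ hn0
      _ ≤ ‖c ^ n‖ * (‖w‖ + 1) ^ n := by gcongr; linarith
      _ < (1 / (‖w‖ + 1)) ^ n * (‖w‖ + 1) ^ n := by gcongr
      _ = 1 := by rw [← mul_pow, one_div_mul_cancel (by positivity), one_pow]
  have hu := (isUnit_one_sub_of_norm_pow_lt_one hlt).mul y.isUnit
  rwa [sub_neg_eq_add, add_mul, one_mul, mul_assoc, Units.inv_mul, mul_one, add_comm] at hu

/-- If `A` is a unital C*-algebra of real rank zero and `T : A → B` is a surjective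
additive spectrum preserving map onto a complex unital Banach algebra, then for every
central projection `e ∈ A` one has `T(ex) = Te · Tx` for all `x ∈ A`. -/
theorem central_projection_multiplicativity
    {A : Type*} [NormedRing A] [StarRing A] [CStarRing A] [NormedAlgebra ℂ A]
    [CompleteSpace A] [StarModule ℂ A]
    (hrr0 : ∀ a : A, IsSelfAdjoint a → a ∈ closure {x : A | IsSelfAdjoint x ∧ IsUnit x})
    {B : Type*} [NormedRing B] [NormedAlgebra ℂ B] [CompleteSpace B]
    (T : A → B)
    (hsurj : Function.Surjective T)
    (hadd : ∀ x y : A, T (x + y) = T x + T y)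
    (hspec : ∀ x : A, spectrum ℂ (T x) = spectrum ℂ x) :
    ∀ e : A, e ∈ Set.center A → IsSelfAdjoint e → IsIdempotentElem e →
      ∀ x : A, T (e * x) = T e * T x := by
  have hunit : ∀ x, IsUnit (T x) ↔ IsUnit x := fun x => by
    rw [← spectrum.zero_notMem_iff ℂ, hspec, spectrum.zero_notMem_iff]
  obtain ⟨F, hF⟩ : ∃ F : A →+ B, ∀ x, F x = T x := ⟨AddMonoidHom.mk' T hadd, fun _ => rfl⟩
  have hpert : ∀ c : B, IsUnitPerturbation c → c = 0 := by
    intro c hc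
    obtain ⟨d, rfl⟩ := hsurj c
    have hd : IsUnitPerturbation d := fun a ha => by
      rw [← hunit, hadd]
      exact hc _ ((hunit a).2 ha)
    rw [hd.eq_zero, ← hF, map_zero]
  have hone : T 1 = 1 := by
    rw [← sub_eq_zero]
    apply hpert
    intro y hy
    obtain ⟨x, rfl⟩ := hsurj y
    have h : T 1 - 1 + T x = T (1 + x) - algebraMap ℂ B 1 := by
      rw [hadd, map_one]; abel
    have hm : (1 : ℂ) ∉ spectrum ℂ (T (1 + x)) := by
      rw [hspec, spectrum.mem_iff, not_not, map_one, sub_add_cancel_left]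
      exact ((hunit x).1 hy).neg
    rw [spectrum.mem_iff, not_not] at hm
    rw [h, ← neg_sub]
    exact hm.neg
  have hcompl : ∀ e : A, T (1 - e) = 1 - T e := fun e => by
    rw [← hF, map_sub, hF, hF, hone]
  have hmain : ∀ e : A, (∀ x, e * x = x * e) → IsIdempotentElem e →
      ∀ u : A, T e * T ((1 - e) * u) = 0 := by
    intro e hec he u
    have hp : ∀ z : B, IsUnit z → IsUnit (z + 1) → IsUnit (z + T e) := by
      intro z hz hz1
      obtain ⟨x, rfl⟩ := hsurj z
      rw [← hone, ← hadd, hunit] at hz1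
      rw [hunit] at hz
      rw [← hadd, hunit]
      have := he.isUnit_mul_add_one_sub_mul hec hz1 hz
      rwa [mul_add, sub_mul, mul_one, one_mul,
        show e * x + e + (x - e * x) = x + e by abel] at this
    have hpc : ∀ x, T e * x = x * T e := fun x =>
      sub_eq_zero.1 (hpert _ (isUnitPerturbation_commutator hp x))
    have hpi : IsIdempotentElem (T e) := by
      rw [IsIdempotentElem, ← sub_eq_zero]
      refine hpert _ (isUnitPerturbation_of_central_of_spectrum_subset
        (fun x => ((show Commute (T e) x from hpc x).mul_left (hpc x)).sub_left (hpc x)) ?_)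
      have hse : spectrum ℂ (T e) ⊆ {0, 1} := by
        rw [hspec]
        exact he.spectrum_subset ℂ
      have hpoly : T e * T e - T e =
          Polynomial.aeval (T e) (Polynomial.X * Polynomial.X - Polynomial.X : Polynomial ℂ) := by
        simp
      rw [hpoly, spectrum.map_polynomial_aeval_of_degree_pos]
      · rintro _ ⟨s, hs, rfl⟩
        rcases hse hs with rfl | rfl <;> simp
      · have : (Polynomial.X * Polynomial.X - Polynomial.X : Polynomial ℂ).degree = 2 := by
          compute_degree!
        simp [this]
    apply hpert
    intro y hy
    obtain ⟨x, rfl⟩ := hsurj y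
    obtain ⟨k, hk⟩ := exists_forall_ge_isUnit_add_natCast (x + u)
    have hxu := he.isUnit_mul_add_one_sub_mul hec ((hunit x).1 hy) (hk k le_rfl)
    have h1 : e * x + (1 - e) * (x + u + k) = x + (1 - e) * u + k • (1 - e) := by
      rw [nsmul_eq_mul, mul_add, mul_add, (Nat.cast_commute k (1 - e)).eq]
      noncomm_ring
    rw [h1, ← hunit, hadd, hadd, ← hF (k • _), map_nsmul, hF, hcompl] at hxu
    have h2 := hpi.isUnit_mul_add_one_sub_mul hpc hxu hy
    have h3 : T e * (T x + T ((1 - e) * u) + k • (1 - T e)) + (1 - T e) * T x =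
        T e * T ((1 - e) * u) + T x := by
      rw [mul_add, mul_add, mul_smul_comm, hpi.mul_one_sub_self, smul_zero, sub_mul (1 : B), one_mul]
      abel
    rwa [h3] at h2
  intro e hec _ he x
  have hec' : ∀ x, e * x = x * e := fun x => (Set.mem_center_iff.1 hec).comm x
  have h1 := hmain e hec' he x
  have h2 := hmain (1 - e) (fun x => by rw [sub_mul, mul_sub, hec']; simp) he.one_sub x
  rw [sub_sub_cancel, hcompl, sub_mul, one_mul, sub_eq_zero] at h2
  rw [h2]
  conv_rhs => rw [show x = e * x + (1 - e) * x by noncomm_ring, hadd, mul_add, h1, add_zero]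
end
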